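/- arXiv:1606.08240 — 2 statements merged into one kernel-verified Lean document; each statement's English description precedes it below -/
import Mathlib

section
/- Let K be a convex body in R^n with nonempty interior and centre of mass at the origin, λ_min(K) the smallest eigenvalue of the coefficient matrix of Φ_{n-1}^2(K), and R = (S(K)/(4π λ_min(K))) (S(K)/ω_n)^{1/(n−1)}. Set r = 2π λ_min(K) / ((n+1)(4R)^{n−2}). Then r B^n ⊆ K. -/
open MeasureTheory Metric Real Filter
open scoped InnerProductSpace ENNReal NNReal Topology

noncomputable section

abbrev En (n : ℕ) := EuclideanSpace ℝ (Fin n)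

abbrev Sph (n : ℕ) : Set (En n) := Metric.sphere 0 1

/-- The spherical Lebesgue (surface) measure on `S^{n-1}` and the surface area
`ω_n` of the unit sphere. -/
def sphLebesgue (n : ℕ) : Measure (Sph n) := μH[((n : ℝ) - 1)]

def omegaN (n : ℕ) : ℝ := (sphLebesgue n Set.univ).toReal

/-- `μ` is the surface area measure `S_{n-1}(K, ·)` of the convex body `K`. -/
def IsSurfaceAreaMeasure {n : ℕ} (K : Set (En n)) (μ : Measure (Sph n)) : Prop :=
  ((interior K).Nonempty ∧ ∀ ω : Set (Sph n), MeasurableSet ω →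
      μ ω = μH[((n : ℝ) - 1)]
        {x ∈ frontier K | ∃ u ∈ ω, ∀ y ∈ K, ⟪y - x, (u : En n)⟫_ℝ ≤ 0})
  ∨ (interior K = ∅ ∧ ∃ u u' : Sph n, (u' : En n) = -(u : En n) ∧
      (∃ c : ℝ, ∀ x ∈ K, ⟪x, (u : En n)⟫_ℝ = c) ∧
      μ = (μH[((n : ℝ) - 1)] K) • (Measure.dirac u + Measure.dirac u'))

/-- The coefficient matrix of the rank-2 surface tensor `Φ_{n-1}²(K)`, namely
`(1/(2! ω_3)) ∫ u_i u_j dS_{n-1}(K, du) = (1/(8π)) M(S_{n-1}(K,·))`. -/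
def rank2TensorMatrix {n : ℕ} (μ : Measure (Sph n)) : Matrix (Fin n) (Fin n) ℝ :=
  Matrix.of fun i j => (1 / (8 * π)) * ∫ u, (u : En n) i * (u : En n) j ∂μ

/-- `l` is an eigenvalue of the real matrix `M`. -/
def IsEigenvalue {n : ℕ} (M : Matrix (Fin n) (Fin n) ℝ) (l : ℝ) : Prop :=
  ∃ v : Fin n → ℝ, v ≠ 0 ∧ Matrix.mulVec M v = l • v

section Coordinates

variable {m : ℕ}

/-- The coordinates of `x` in the basis `b`, the one of index `0` excepted. -/
def dropCoord (b : OrthonormalBasis (Fin (m + 1)) ℝ (En (m + 1))) (x : En (m + 1)) : Fin m → ℝ :=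
  fun i => b.repr x i.succ

lemma dropCoord_sub (b : OrthonormalBasis (Fin (m + 1)) ℝ (En (m + 1))) (x y : En (m + 1)) :
    dropCoord b (x - y) = dropCoord b x - dropCoord b y := by
  ext i; simp [dropCoord]

lemma dropCoord_smul (b : OrthonormalBasis (Fin (m + 1)) ℝ (En (m + 1))) (t : ℝ)
    (x : En (m + 1)) : dropCoord b (t • x) = t • dropCoord b x := by
  ext i; simp [dropCoord]

lemma norm_dropCoord_le (b : OrthonormalBasis (Fin (m + 1)) ℝ (En (m + 1))) (x : En (m + 1)) :
    ‖dropCoord b x‖ ≤ ‖x‖ := by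
  refine (pi_norm_le_iff_of_nonneg (norm_nonneg _)).2 fun i => ?_
  have := PiLp.norm_apply_le (b.repr x) i.succ
  simpa [dropCoord] using this

lemma lipschitzWith_dropCoord (b : OrthonormalBasis (Fin (m + 1)) ℝ (En (m + 1))) :
    LipschitzWith 1 (dropCoord b) := by
  refine LipschitzWith.of_dist_le_mul fun x y => ?_
  rw [dist_eq_norm, dist_eq_norm, ← dropCoord_sub]
  simpa using norm_dropCoord_le b (x - y)

lemma norm_sq_eq_inner_sq_add_sum (b : OrthonormalBasis (Fin (m + 1)) ℝ (En (m + 1)))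
    (x : En (m + 1)) : ‖x‖ ^ 2 = ⟪b 0, x⟫_ℝ ^ 2 + ∑ i, dropCoord b x i ^ 2 := by
  rw [← b.sum_sq_norm_inner_right x, Fin.sum_univ_succ]
  simp [dropCoord, b.repr_apply_apply]

lemma volume_tail_mem_inter_zero_mem (F : Set (Fin m → ℝ)) (I : Set ℝ) :
    volume {x : Fin (m + 1) → ℝ | x 0 ∈ I ∧ (fun i : Fin m => x i.succ) ∈ F}
      = volume I * volume F := by
  have h := (volume_preserving_piFinSuccAbove (fun _ : Fin (m + 1) => ℝ) 0)
  have h2 := h.measure_preimage_equiv (I ×ˢ F)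
  rw [Measure.volume_eq_prod, Measure.prod_prod] at h2
  rw [← h2]
  congr 1

lemma volume_prism (b : OrthonormalBasis (Fin (m + 1)) ℝ (En (m + 1))) (F : Set (Fin m → ℝ)) :
    volume {x : En (m + 1) | ⟪b 0, x⟫_ℝ ∈ Set.Icc (0 : ℝ) 1 ∧ dropCoord b x ∈ F} = volume F := by
  have h := b.measurePreserving_measurableEquiv.trans
    (EuclideanSpace.volume_preserving_symm_measurableEquiv_toLp (Fin (m + 1)))
  have h2 := MeasurePreserving.measure_preimage_equiv
    (f := b.measurableEquiv.trans (MeasurableEquiv.toLp 2 (Fin (m + 1) → ℝ)).symm) h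
    {x : Fin (m + 1) → ℝ | x 0 ∈ Set.Icc (0 : ℝ) 1 ∧ (fun i : Fin m => x i.succ) ∈ F}
  rw [volume_tail_mem_inter_zero_mem] at h2
  simp only [Real.volume_Icc, sub_zero, ENNReal.ofReal_one, one_mul] at h2
  rw [← h2]
  congr 1
  ext x
  simp only [← b.repr_apply_apply]
  rfl

end Coordinates

section Determinant

variable {E : Type*} [NormedAddCommGroup E] [InnerProductSpace ℝ E]

/-- The linear map sending `v` to `e` and acting on the complement of `v` as the orthogonal
projection to the complement of `e`. -/
def tiltMap (e v : E) : E →L[ℝ] E :=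
  ContinuousLinearMap.id ℝ E - (innerSL ℝ v).smulRight v
    - (innerSL ℝ e - ⟪e, v⟫_ℝ • innerSL ℝ v).smulRight e + (innerSL ℝ v).smulRight e

lemma tiltMap_apply (e v x : E) :
    tiltMap e v x = x - ⟪v, x⟫_ℝ • v - (⟪e, x⟫_ℝ - ⟪e, v⟫_ℝ * ⟪v, x⟫_ℝ) • e + ⟪v, x⟫_ℝ • e := by
  simp [tiltMap]

lemma det_tiltMap [FiniteDimensional ℝ E] {e v : E} (he : ‖e‖ = 1) (hv : ‖v‖ = 1)
    (hev : ⟪e, v⟫_ℝ ≠ 0) : (tiltMap e v).det = ⟪e, v⟫_ℝ := by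
  have hee : ⟪e, e⟫_ℝ = 1 := by rw [real_inner_self_eq_norm_sq, he]; norm_num
  have hvv : ⟪v, v⟫_ℝ = 1 := by rw [real_inner_self_eq_norm_sq, hv]; norm_num
  have key : ((tiltMap e v : E →L[ℝ] E) : E →ₗ[ℝ] E)
      = (LinearMap.transvection (innerₛₗ ℝ ((⟪e, v⟫_ℝ)⁻¹ • v - e)) e)
        ∘ₗ (LinearMap.transvection (innerₛₗ ℝ v) (e - v)) := by
    ext x
    simp only [ContinuousLinearMap.coe_coe, tiltMap_apply, LinearMap.comp_apply,
      LinearMap.transvection.apply, innerₛₗ_apply_apply, inner_add_right, inner_sub_left,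
      inner_sub_right, inner_smul_left, inner_smul_right, hee, hvv, real_inner_comm e v,
      RCLike.conj_to_real]
    match_scalars <;> field_simp
    ring
  rw [ContinuousLinearMap.det, key, LinearMap.det_comp, LinearMap.transvection.det,
    LinearMap.transvection.det]
  simp only [innerₛₗ_apply_apply, inner_sub_left, inner_sub_right, inner_smul_left, hee, hvv,
    real_inner_comm e v, RCLike.conj_to_real]
  field_simp
  ring

end Determinant

section Tilt

variable {m : ℕ}

lemma exists_orthonormalBasis_zero_eq (v : En (m + 1)) (hv : ‖v‖ = 1) :
    ∃ b : OrthonormalBasis (Fin (m + 1)) ℝ (En (m + 1)), b 0 = v := by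
  have h : Orthonormal ℝ (({0} : Set (Fin (m + 1))).domRestrict (fun _ : Fin (m + 1) => v)) := by
    refine ⟨fun _ => hv, fun i j hij => ?_⟩
    exact absurd (Subsingleton.elim i j) hij
  obtain ⟨b, hb⟩ := h.exists_orthonormalBasis_extension_of_card_eq (by simp)
  exact ⟨b, hb 0 rfl⟩

lemma hausdorffMeasure_le_of_antilipschitz_dropCoord
    (b : OrthonormalBasis (Fin (m + 1)) ℝ (En (m + 1))) (T : Set (En (m + 1))) (κ : ℝ≥0)
    (h : ∀ x ∈ T, ∀ y ∈ T, ‖x - y‖ ≤ κ * ‖dropCoord b (x - y)‖) :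
    μH[(m : ℝ)] T ≤ (κ : ℝ≥0∞) ^ m * volume (dropCoord b '' T) := by
  set g := Function.invFunOn (dropCoord b) T
  have hinj : Set.InjOn (dropCoord b) T := fun x hx y hy hxy => by
    have := h x hx y hy
    rw [dropCoord_sub, hxy, sub_self, norm_zero, mul_zero] at this
    exact sub_eq_zero.1 (norm_le_zero_iff.1 this)
  have hg : ∀ x ∈ T, g (dropCoord b x) = x := fun x hx => hinj.leftInvOn_invFunOn hx
  have hlip : LipschitzOnWith κ g (dropCoord b '' T) := by
    refine LipschitzOnWith.of_dist_le_mul ?_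
    rintro _ ⟨x, hx, rfl⟩ _ ⟨y, hy, rfl⟩
    rw [hg x hx, hg y hy, dist_eq_norm, dist_eq_norm, ← dropCoord_sub]
    exact h x hx y hy
  have himg : g '' (dropCoord b '' T) = T := by
    rw [Set.image_image]
    exact (Set.image_congr hg).trans (Set.image_id' T)
  have := hlip.hausdorffMeasure_image_le (d := (m : ℝ)) (by positivity)
  rw [himg] at this
  have hpi := hausdorffMeasure_pi_real (ι := Fin m)
  rw [Fintype.card_fin] at hpi
  rw [hpi] at this
  simpa using this

lemma norm_sq_le_of_abs_inner_le (b : OrthonormalBasis (Fin (m + 1)) ℝ (En (m + 1)))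
    {ε s : ℝ} (hs : 1 ≤ s ^ 2 * (1 - ε ^ 2)) {d : En (m + 1)} (hd : |⟪b 0, d⟫_ℝ| ≤ ε * ‖d‖) :
    ‖d‖ ^ 2 ≤ s ^ 2 * ∑ i, dropCoord b d i ^ 2 := by
  have h1 := norm_sq_eq_inner_sq_add_sum b d
  have h2 : ⟪b 0, d⟫_ℝ ^ 2 ≤ ε ^ 2 * ‖d‖ ^ 2 := by
    rw [← mul_pow, ← sq_abs]
    gcongr
  nlinarith [sq_nonneg s, sq_nonneg (‖d‖)]

lemma sum_dropCoord_sq_le (b : OrthonormalBasis (Fin (m + 1)) ℝ (En (m + 1)))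
    (x : En (m + 1)) : ∑ i, dropCoord b x i ^ 2 ≤ m * ‖dropCoord b x‖ ^ 2 := by
  calc ∑ i, dropCoord b x i ^ 2 ≤ ∑ _i : Fin m, ‖dropCoord b x‖ ^ 2 := by
        refine Finset.sum_le_sum fun i _ => ?_
        rw [← sq_abs]
        have := norm_le_pi_norm (dropCoord b x) i
        rw [Real.norm_eq_abs] at this
        gcongr
    _ = _ := by simp

/-- The part of a set lying in a nearly flat piece with normal `v` shrinks by at most the factor
`|⟪b 0, v⟫|` under the projection along `b 0`. -/
lemma exists_projection_lower_bound (b : OrthonormalBasis (Fin (m + 1)) ℝ (En (m + 1)))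
    (v : En (m + 1)) (hv : ‖v‖ = 1) (hbv : ⟪b 0, v⟫_ℝ ≠ 0) (θ : ℝ) (hθ : 1 < θ) :
    ∃ ε > 0, ∀ T : Set (En (m + 1)),
      (∀ x ∈ T, ∀ y ∈ T, |⟪v, x - y⟫_ℝ| ≤ ε * ‖x - y‖) →
      ENNReal.ofReal |⟪b 0, v⟫_ℝ| * μH[(m : ℝ)] T
        ≤ ENNReal.ofReal (θ ^ 2) * (ENNReal.ofReal √m ^ m * volume (dropCoord b '' T)) := by
  obtain ⟨b', rfl⟩ := exists_orthonormalBasis_zero_eq v hv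
  set p := |⟪b 0, b' 0⟫_ℝ| with hp
  have hp0 : 0 < p := abs_pos.2 hbv
  have hθ0 : 0 < θ := by linarith
  have hdet := det_tiltMap (b.norm_eq_one 0) hv hbv
  have hlt : ((p / θ).toNNReal : ℝ≥0∞) < ENNReal.ofReal |(tiltMap (b 0) (b' 0)).det| := by
    rw [hdet, ← hp]
    exact (ENNReal.ofReal_lt_ofReal_iff hp0).2 (div_lt_self hp0 hθ)
  have hev := mul_le_addHaar_image_of_lt_det (volume : Measure (En (m + 1))) _ hlt
  obtain ⟨δ, hδ, hδ0⟩ := (hev.and self_mem_nhdsWithin).exists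
  have hδ0 : 0 < δ := hδ0
  obtain ⟨s, hs1, hsm⟩ : ∃ s : ℝ, 1 < s ∧ s ^ m ≤ θ := by
    have hc : Tendsto (fun s : ℝ => s ^ m) (𝓝[>] 1) (𝓝 (1 ^ m)) :=
      ((continuous_pow m).tendsto 1).mono_left nhdsWithin_le_nhds
    rw [one_pow] at hc
    obtain ⟨s, h1, h2⟩ := ((hc.eventually (eventually_le_nhds hθ)).and self_mem_nhdsWithin).exists
    exact ⟨s, h2, h1⟩
  obtain ⟨ε, hε0, hεs, hεδ⟩ : ∃ ε : ℝ, 0 < ε ∧ 1 ≤ s ^ 2 * (1 - ε ^ 2) ∧ ε * s ≤ δ := by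
    have h1 : Tendsto (fun ε : ℝ => s ^ 2 * (1 - ε ^ 2)) (𝓝[>] 0) (𝓝 (s ^ 2 * (1 - 0 ^ 2))) :=
      (Continuous.tendsto (by fun_prop) 0).mono_left nhdsWithin_le_nhds
    have h2 : Tendsto (fun ε : ℝ => ε * s) (𝓝[>] 0) (𝓝 (0 * s)) :=
      (Continuous.tendsto (by fun_prop) 0).mono_left nhdsWithin_le_nhds
    have e1 := h1.eventually (eventually_ge_nhds (b := 1) (by nlinarith))
    have e2 := h2.eventually (eventually_le_nhds (b := (δ : ℝ)) (by simpa using hδ0))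
    obtain ⟨ε, ⟨h1, h2⟩, h3⟩ := ((e1.and e2).and self_mem_nhdsWithin).exists
    exact ⟨ε, h3, h1, h2⟩
  have hs0 : 0 < s := by linarith
  refine ⟨ε, hε0, fun T hT => ?_⟩
  set Y := {y : En (m + 1) | ⟪b' 0, y⟫_ℝ ∈ Set.Icc (0 : ℝ) 1 ∧ dropCoord b' y ∈ dropCoord b' '' T}
  have hch : ∀ y : En (m + 1), ∃ x, y ∈ Y → x ∈ T ∧ dropCoord b' x = dropCoord b' y := by
    intro y
    by_cases h : y ∈ Y
    · obtain ⟨x, hx, hxy⟩ := h.2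
      exact ⟨x, fun _ => ⟨hx, hxy⟩⟩
    · exact ⟨0, fun h' => absurd h' h⟩
  choose X hX using hch
  set f : En (m + 1) → En (m + 1) :=
    fun y => X y - ⟪b 0, X y⟫_ℝ • b 0 + ⟪b' 0, y⟫_ℝ • b 0 with hf
  have hproj : ∀ z : En (m + 1), ∀ z', dropCoord b' z = dropCoord b' z' →
      z - ⟪b' 0, z⟫_ℝ • b' 0 = z' - ⟪b' 0, z'⟫_ℝ • b' 0 := by
    intro z z' h
    refine b'.repr.injective ?_
    ext i
    refine Fin.cases ?_ (fun j => ?_) i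
    · simp [b'.repr_apply_apply]
    · simpa [dropCoord] using congrFun h j
  have happ : ApproximatesLinearOn f (tiltMap (b 0) (b' 0)) Y δ := by
    intro y hy y' hy'
    obtain ⟨hx, hxy⟩ := hX y hy
    obtain ⟨hx', hxy'⟩ := hX y' hy'
    set d := X y - X y' with hd
    have hdd : dropCoord b' d = dropCoord b' (y - y') := by
      rw [dropCoord_sub, dropCoord_sub, hxy, hxy']
    have hz : y - y' = d - ⟪b' 0, d⟫_ℝ • b' 0 + ⟪b' 0, y - y'⟫_ℝ • b' 0 := by
      rw [hproj _ _ hdd]; abel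
    have hdiff : f y - f y' - tiltMap (b 0) (b' 0) (y - y')
        = ⟪b' 0, d⟫_ℝ • (b' 0 - ⟪b 0, b' 0⟫_ℝ • b 0) := by
      have e1 : f y - f y' = d - ⟪b 0, d⟫_ℝ • b 0 + ⟪b' 0, y - y'⟫_ℝ • b 0 := by
        simp only [hf, hd, inner_sub_right]
        module
      have e2 : ⟪b 0, y - y'⟫_ℝ = ⟪b 0, d⟫_ℝ - ⟪b' 0, d⟫_ℝ * ⟪b 0, b' 0⟫_ℝ
          + ⟪b' 0, y - y'⟫_ℝ * ⟪b 0, b' 0⟫_ℝ := by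
        conv_lhs => rw [hz]
        simp only [inner_add_right, inner_sub_right, inner_smul_right]
      have e3 : tiltMap (b 0) (b' 0) (y - y') = d - ⟪b' 0, d⟫_ℝ • b' 0
          - (⟪b 0, d⟫_ℝ - ⟪b' 0, d⟫_ℝ * ⟪b 0, b' 0⟫_ℝ) • b 0 + ⟪b' 0, y - y'⟫_ℝ • b 0 := by
        have h0 : y - y' - ⟪b' 0, y - y'⟫_ℝ • b' 0 = d - ⟪b' 0, d⟫_ℝ • b' 0 :=
          (hproj _ _ hdd).symm
        rw [tiltMap_apply, h0, e2]
        module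
      rw [e1, e3]
      module
    have hperp : ‖b' 0 - ⟪b 0, b' 0⟫_ℝ • b 0‖ ≤ 1 := by
      have : ‖b' 0 - ⟪b 0, b' 0⟫_ℝ • b 0‖ ^ 2 ≤ 1 := by
        rw [norm_sub_sq_real, norm_smul, inner_smul_right, b.norm_eq_one, b'.norm_eq_one,
          real_inner_comm, Real.norm_eq_abs, mul_one, sq_abs]
        nlinarith [sq_nonneg ⟪b 0, b' 0⟫_ℝ]
      nlinarith [norm_nonneg (b' 0 - ⟪b 0, b' 0⟫_ℝ • b 0)]
    have hinner := hT _ hx _ hx'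
    have hdn : ‖d‖ ≤ s * ‖y - y'‖ := by
      have h1 := norm_sq_le_of_abs_inner_le b' hεs hinner
      have h2 := norm_sq_eq_inner_sq_add_sum b' (y - y')
      rw [← hd, hdd] at h1
      refine abs_le_of_sq_le_sq' ?_ (by positivity) |>.2
      rw [mul_pow]
      refine h1.trans ?_
      gcongr
      nlinarith [sq_nonneg ⟪b' 0, y - y'⟫_ℝ]
    rw [hdiff, norm_smul, Real.norm_eq_abs]
    calc |⟪b' 0, d⟫_ℝ| * ‖b' 0 - ⟪b 0, b' 0⟫_ℝ • b 0‖ ≤ (ε * ‖d‖) * 1 := by gcongr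
      _ ≤ ε * (s * ‖y - y'‖) := by rw [mul_one]; gcongr
      _ = (ε * s) * ‖y - y'‖ := by ring
      _ ≤ δ * ‖y - y'‖ := by gcongr
  have hmain := hδ Y f happ
  have himg : f '' Y ⊆ {x | ⟪b 0, x⟫_ℝ ∈ Set.Icc (0 : ℝ) 1 ∧ dropCoord b x ∈ dropCoord b '' T} := by
    rintro _ ⟨y, hy, rfl⟩
    refine ⟨?_, X y, (hX y hy).1, ?_⟩
    · have : ⟪b 0, f y⟫_ℝ = ⟪b' 0, y⟫_ℝ := by
        simp [hf, inner_add_right, inner_sub_right, inner_smul_right]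
      rw [this]; exact hy.1
    · ext i
      simp [dropCoord, hf]
  have hvol := hmain.trans (measure_mono himg)
  rw [volume_prism, volume_prism] at hvol
  have hH := hausdorffMeasure_le_of_antilipschitz_dropCoord b' T (s * √m).toNNReal (by
    intro x hx y hy
    have h1 := norm_sq_le_of_abs_inner_le b' hεs (hT x hx y hy)
    have h2 := sum_dropCoord_sq_le b' (x - y)
    rw [Real.coe_toNNReal _ (by positivity)]
    refine abs_le_of_sq_le_sq' ?_ (by positivity) |>.2
    rw [mul_pow, mul_pow, Real.sq_sqrt (by positivity), mul_assoc]
    exact h1.trans (by gcongr))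
  have hsm' : (((s * √m).toNNReal : ℝ≥0) : ℝ≥0∞) ^ m
      ≤ ENNReal.ofReal θ * ENNReal.ofReal √m ^ m := by
    change ENNReal.ofReal (s * √m) ^ m ≤ _
    rw [ENNReal.ofReal_mul hs0.le, mul_pow]
    gcongr
    rw [← ENNReal.ofReal_pow hs0.le]
    exact ENNReal.ofReal_le_ofReal hsm
  have hpθ : ENNReal.ofReal p = ENNReal.ofReal θ * ENNReal.ofReal (p / θ) := by
    rw [← ENNReal.ofReal_mul hθ0.le]; congr 1; field_simp
  calc ENNReal.ofReal p * μH[(m : ℝ)] T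
      ≤ ENNReal.ofReal p * (ENNReal.ofReal θ * ENNReal.ofReal √m ^ m
          * volume (dropCoord b' '' T)) := by
        gcongr
        exact hH.trans (by gcongr)
    _ = ENNReal.ofReal θ * ENNReal.ofReal θ * (ENNReal.ofReal √m ^ m
          * (ENNReal.ofReal (p / θ) * volume (dropCoord b' '' T))) := by
        rw [hpθ]; ring
    _ ≤ ENNReal.ofReal θ * ENNReal.ofReal θ * (ENNReal.ofReal √m ^ m
          * volume (dropCoord b '' T)) := by
        gcongr
        exact hvol
    _ = _ := by rw [← ENNReal.ofReal_mul hθ0.le, sq]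

end Tilt

section NormalSet

variable {m : ℕ}

/-- The boundary points of `K` at which some element of `ω` is an outer normal. -/
def normalSet {n : ℕ} (K : Set (En n)) (ω : Set (Sph n)) : Set (En n) :=
  {x ∈ frontier K | ∃ u ∈ ω, ∀ y ∈ K, ⟪y - x, (u : En n)⟫_ℝ ≤ 0}

lemma normalSet_union {n : ℕ} (K : Set (En n)) (ω η : Set (Sph n)) :
    normalSet K (ω ∪ η) = normalSet K ω ∪ normalSet K η := by
  ext x
  simp only [normalSet, Set.mem_union, Set.mem_ofPred_eq]
  constructor
  · rintro ⟨hx, u, hu | hu, h⟩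
    · exact Or.inl ⟨hx, u, hu, h⟩
    · exact Or.inr ⟨hx, u, hu, h⟩
  · rintro (⟨hx, u, hu, h⟩ | ⟨hx, u, hu, h⟩)
    · exact ⟨hx, u, Or.inl hu, h⟩
    · exact ⟨hx, u, Or.inr hu, h⟩

lemma normalSet_iUnion {n : ℕ} {ι : Sort*} (K : Set (En n)) (ω : ι → Set (Sph n)) :
    normalSet K (⋃ i, ω i) = ⋃ i, normalSet K (ω i) := by
  ext x
  simp only [normalSet, Set.mem_iUnion, Set.mem_ofPred_eq]
  constructor
  · rintro ⟨hx, u, ⟨i, hu⟩, h⟩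
    exact ⟨i, hx, u, hu, h⟩
  · rintro ⟨i, hx, u, hu, h⟩
    exact ⟨hx, u, ⟨i, hu⟩, h⟩

lemma normalSet_mono {n : ℕ} (K : Set (En n)) {ω η : Set (Sph n)} (h : ω ⊆ η) :
    normalSet K ω ⊆ normalSet K η :=
  fun _ ⟨hx, u, hu, hy⟩ => ⟨hx, u, h hu, hy⟩

lemma normalSet_subset {n : ℕ} {K : Set (En n)} (hK : IsClosed K) (ω : Set (Sph n)) :
    normalSet K ω ⊆ K :=
  fun _ hx => hK.frontier_subset hx.1

lemma isCompact_normalSet {n : ℕ} {K : Set (En n)} (hK : IsCompact K) {C : Set (Sph n)}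
    (hC : IsClosed C) : IsCompact (normalSet K C) := by
  have hfr : IsCompact (frontier K) :=
    hK.of_isClosed_subset isClosed_frontier hK.isClosed.frontier_subset
  have hcl : IsClosed {p : En n × Sph n | ∀ y ∈ K, ⟪y - p.1, (p.2 : En n)⟫_ℝ ≤ 0} := by
    simp only [Set.ofPred_forall]
    refine isClosed_iInter fun y => isClosed_iInter fun _ => ?_
    exact isClosed_le (by fun_prop) continuous_const
  have h := ((hfr.prod hC.isCompact).inter_right hcl).image continuous_fst
  convert h using 1
  ext x
  simp only [normalSet, Set.mem_ofPred_eq, Set.mem_image, Set.mem_inter_iff, Set.mem_prod,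
    Prod.exists, exists_and_right, exists_eq_right]
  constructor
  · rintro ⟨hx, u, hu, h⟩
    exact ⟨u, ⟨hx, hu⟩, h⟩
  · rintro ⟨u, ⟨hx, hu⟩, h⟩
    exact ⟨hx, u, hu, h⟩

lemma exists_normalSet_eq_iUnion_isCompact {n : ℕ} {K : Set (En n)} (hK : IsCompact K)
    {C O : Set (Sph n)} (hC : IsClosed C) (hO : IsOpen O) :
    ∃ F : ℕ → Set (En n), (∀ i, IsCompact (F i)) ∧ normalSet K (C ∩ O) = ⋃ i, F i := by
  obtain ⟨G, hG, -, hGO, -⟩ := hO.exists_iUnion_isClosed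
  refine ⟨fun i => normalSet K (C ∩ G i), fun i => isCompact_normalSet hK (hC.inter (hG i)), ?_⟩
  rw [← normalSet_iUnion, ← Set.inter_iUnion, hGO]

lemma abs_inner_sub_le_of_mem_normalSet {n : ℕ} {K : Set (En n)} (hK : IsClosed K) {v : Sph n}
    {ε : ℝ} {x y : En n} (hx : x ∈ normalSet K (closedBall v ε))
    (hy : y ∈ normalSet K (closedBall v ε)) : |⟪(v : En n), x - y⟫_ℝ| ≤ ε * ‖x - y‖ := by
  have key : ∀ x y : En n, x ∈ normalSet K (closedBall v ε) → y ∈ K →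
      ⟪(v : En n), y - x⟫_ℝ ≤ ε * ‖x - y‖ := by
    rintro x y ⟨-, u, hu, h⟩ hy
    have h1 : ‖(v : En n) - u‖ ≤ ε := by
      rw [← dist_eq_norm, dist_comm]
      exact hu
    have h2 : ⟪(v : En n) - u, y - x⟫_ℝ ≤ ‖(v : En n) - u‖ * ‖y - x‖ := real_inner_le_norm _ _
    have h3 := h y hy
    rw [inner_sub_left] at h2
    rw [real_inner_comm] at h3
    rw [norm_sub_rev y x] at h2
    nlinarith [norm_nonneg (x - y)]
  have h1 := key x y hx (normalSet_subset hK _ hy)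
  have h2 := key y x hy (normalSet_subset hK _ hx)
  rw [norm_sub_rev] at h2
  rw [← neg_sub x y, inner_neg_right] at h1
  exact abs_le.2 ⟨by linarith, h2⟩

lemma eq_of_dropCoord_eq_of_normal (b : OrthonormalBasis (Fin (m + 1)) ℝ (En (m + 1)))
    {K : Set (En (m + 1))} {x y u u' : En (m + 1)} {σ : ℝ} (hx : x ∈ K) (hy : y ∈ K)
    (hu : ∀ z ∈ K, ⟪z - x, u⟫_ℝ ≤ 0) (hu' : ∀ z ∈ K, ⟪z - y, u'⟫_ℝ ≤ 0)
    (hσ : 0 < σ * ⟪b 0, u⟫_ℝ) (hσ' : 0 < σ * ⟪b 0, u'⟫_ℝ)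
    (h : dropCoord b x = dropCoord b y) : x = y := by
  have hd : y - x = ⟪b 0, y - x⟫_ℝ • b 0 := by
    refine b.repr.injective ?_
    ext i
    refine Fin.cases ?_ (fun j => ?_) i
    · simp [b.repr_apply_apply, inner_sub_right]
    · simpa [dropCoord, sub_eq_zero] using (congrFun h j).symm
  set t := ⟪b 0, y - x⟫_ℝ
  have h1 := hu y hy
  have h2 := hu' x hx
  rw [hd, inner_smul_left] at h1
  rw [← neg_sub, hd, inner_neg_left, inner_smul_left] at h2
  simp only [RCLike.conj_to_real] at h1 h2
  have ht : t = 0 := by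
    by_contra hne
    rcases lt_or_gt_of_ne hne with hlt | hgt
    · have a1 : 0 ≤ ⟪b 0, u⟫_ℝ := by nlinarith
      have a2 : ⟪b 0, u'⟫_ℝ ≤ 0 := by nlinarith
      nlinarith [mul_pos hσ hσ', mul_nonneg (sq_nonneg σ) (mul_nonneg a1 (neg_nonneg.2 a2))]
    · have a1 : ⟪b 0, u⟫_ℝ ≤ 0 := by nlinarith
      have a2 : 0 ≤ ⟪b 0, u'⟫_ℝ := by nlinarith
      nlinarith [mul_pos hσ hσ', mul_nonneg (sq_nonneg σ) (mul_nonneg a2 (neg_nonneg.2 a1))]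
  rw [ht, zero_smul, sub_eq_zero] at hd
  exact hd.symm

lemma volume_image_dropCoord_le (b : OrthonormalBasis (Fin (m + 1)) ℝ (En (m + 1)))
    (T : Set (En (m + 1))) : volume (dropCoord b '' T) ≤ μH[(m : ℝ)] T := by
  have h := (lipschitzWith_dropCoord b).hausdorffMeasure_image_le (d := (m : ℝ))
    (by positivity) T
  have hpi := hausdorffMeasure_pi_real (ι := Fin m)
  rw [Fintype.card_fin] at hpi
  rw [hpi] at h
  simpa using h

lemma hausdorffMeasure_normalSet_inter_eq_zero {K : Set (En (m + 1))}
    {μ : Measure (Sph (m + 1))}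
    (hμ : ∀ ω, MeasurableSet ω → μ ω = μH[(m : ℝ)] (normalSet K ω)) {ω η : Set (Sph (m + 1))}
    (hω : MeasurableSet ω) (hη : MeasurableSet η) (hd : Disjoint ω η)
    (hη' : MeasurableSet (normalSet K η)) (hωf : μ ω ≠ ∞) (hηf : μ η ≠ ∞) :
    μH[(m : ℝ)] (normalSet K ω ∩ normalSet K η) = 0 := by
  have h := measure_union_add_inter (μ := μH[(m : ℝ)]) (normalSet K ω) hη'
  rw [← normalSet_union, ← hμ _ (hω.union hη), ← hμ _ hω, ← hμ _ hη,
    measure_union hd hη] at h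
  refine (ENNReal.add_right_inj (ENNReal.add_ne_top.2 ⟨hωf, hηf⟩)).1 ?_
  rw [h, add_zero]

/-- One side of the Cauchy projection formula, as an inequality. -/
lemma lintegral_ofReal_inner_le_mul {K : Set (En (m + 1))} (hK : IsCompact K)
    {μ : Measure (Sph (m + 1))}
    (hμ : ∀ ω, MeasurableSet ω → μ ω = μH[(m : ℝ)] (normalSet K ω))
    (b : OrthonormalBasis (Fin (m + 1)) ℝ (En (m + 1))) {σ : ℝ} (hσ : |σ| = 1)
    {θ : ℝ} (hθ : 1 < θ) :
    ∫⁻ v : Sph (m + 1), ENNReal.ofReal (σ * ⟪b 0, (v : En (m + 1))⟫_ℝ) ∂μ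
      ≤ ENNReal.ofReal (θ ^ 3) * (ENNReal.ofReal √m ^ m * volume (dropCoord b '' K)) := by
  have hθ0 : 0 < θ := by linarith
  set O : Set (Sph (m + 1)) := {v | 0 < σ * ⟪b 0, (v : En (m + 1))⟫_ℝ} with hO
  have hloc : ∀ v : Sph (m + 1), ∃ ε > 0, v ∈ O →
      (∀ T : Set (En (m + 1)),
        (∀ x ∈ T, ∀ y ∈ T, |⟪(v : En (m + 1)), x - y⟫_ℝ| ≤ ε * ‖x - y‖) →
        ENNReal.ofReal (σ * ⟪b 0, (v : En (m + 1))⟫_ℝ) * μH[(m : ℝ)] T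
          ≤ ENNReal.ofReal (θ ^ 2) * (ENNReal.ofReal √m ^ m * volume (dropCoord b '' T))) ∧
      ∀ u ∈ closedBall v ε, 0 < σ * ⟪b 0, (u : En (m + 1))⟫_ℝ ∧
        σ * ⟪b 0, (u : En (m + 1))⟫_ℝ ≤ θ * (σ * ⟪b 0, (v : En (m + 1))⟫_ℝ) := by
    intro v
    by_cases hv : v ∈ O
    swap
    · exact ⟨1, one_pos, fun h => absurd h hv⟩
    have hv' : 0 < σ * ⟪b 0, (v : En (m + 1))⟫_ℝ := hv
    have hbv : ⟪b 0, (v : En (m + 1))⟫_ℝ ≠ 0 := fun h => by simp [h] at hv'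
    have habs : |⟪b 0, (v : En (m + 1))⟫_ℝ| = σ * ⟪b 0, (v : En (m + 1))⟫_ℝ := by
      rw [← abs_of_pos hv', abs_mul, hσ, one_mul]
    obtain ⟨ε, hε, h⟩ := exists_projection_lower_bound b v (by simp) hbv θ hθ
    rw [habs] at h
    set p := σ * ⟪b 0, (v : En (m + 1))⟫_ℝ
    have hmin : 0 < min ε (min ((θ - 1) * p) (p / 2)) := by
      refine lt_min hε (lt_min (mul_pos (by linarith) hv') (by linarith))
    refine ⟨min ε (min ((θ - 1) * p) (p / 2)), hmin, fun _ => ⟨fun T hT => h T fun x hx y hy => ?_,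
      fun u hu => ?_⟩⟩
    · exact (hT x hx y hy).trans (by gcongr; exact min_le_left _ _)
    · have h1 : ‖(u : En (m + 1)) - v‖ ≤ min ε (min ((θ - 1) * p) (p / 2)) := by
        rw [← dist_eq_norm]
        exact hu
      have h2 : |σ * ⟪b 0, (u : En (m + 1))⟫_ℝ - p| ≤ ‖(u : En (m + 1)) - v‖ := by
        rw [← mul_sub, ← inner_sub_right, abs_mul, hσ, one_mul]
        simpa using abs_real_inner_le_norm (b 0) ((u : En (m + 1)) - v)
      have h3 := abs_le.1 (h2.trans h1)
      have h4 : min ε (min ((θ - 1) * p) (p / 2)) ≤ (θ - 1) * p :=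
        (min_le_right _ _).trans (min_le_left _ _)
      have h5 : min ε (min ((θ - 1) * p) (p / 2)) ≤ p / 2 :=
        (min_le_right _ _).trans (min_le_right _ _)
      constructor <;> linarith [h3.1, h3.2]
  choose ε hε hloc using hloc
  obtain ⟨t, htO, htc, ht⟩ := TopologicalSpace.countable_cover_nhdsWithin
    (f := fun v => closedBall v (ε v)) (s := O)
    fun v _ => mem_nhdsWithin_of_mem_nhds (closedBall_mem_nhds v (hε v))
  rcases t.eq_empty_or_nonempty with rfl | htne
  · have hz : ∀ v : Sph (m + 1), ENNReal.ofReal (σ * ⟪b 0, (v : En (m + 1))⟫_ℝ) = 0 := by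
      intro v
      refine ENNReal.ofReal_of_nonpos (not_lt.1 fun hv => ?_)
      simpa using ht hv
    simp [hz]
  obtain ⟨c, rfl⟩ := htc.exists_eq_range htne
  have hcO : ∀ i, c i ∈ O := fun i => htO ⟨i, rfl⟩
  set C : ℕ → Set (Sph (m + 1)) := fun i => closedBall (c i) (ε (c i)) with hC
  set U := disjointed C with hU
  have hUO : ∀ i, ∃ G, IsOpen G ∧ U i = C i ∩ G := fun i =>
    ⟨⋂ j < i, (C j)ᶜ, (Set.finite_Iio i).isOpen_biInter
      fun j _ => isClosed_closedBall.isOpen_compl, disjointed_eq_inter_compl C i⟩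
  have hUm : ∀ i, MeasurableSet (U i) := fun i => by
    obtain ⟨G, hG, h⟩ := hUO i
    rw [h]
    exact isClosed_closedBall.measurableSet.inter hG.measurableSet
  have hUC : ∀ i, U i ⊆ C i := fun i => disjointed_subset C i
  have hUpos : ∀ i, ∀ v ∈ U i, 0 < σ * ⟪b 0, (v : En (m + 1))⟫_ℝ := fun i v hv =>
    ((hloc (c i) (hcO i)).2 v (hUC i hv)).1
  set T : ℕ → Set (En (m + 1)) := fun i => normalSet K (U i) with hT
  have hcpt : ∀ i, ∃ F : ℕ → Set (En (m + 1)), (∀ j, IsCompact (F j)) ∧ T i = ⋃ j, F j := by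
    intro i
    obtain ⟨G, hG, h⟩ := hUO i
    simp only [hT, h]
    exact exists_normalSet_eq_iUnion_isCompact hK isClosed_closedBall hG
  have hTm : ∀ i, MeasurableSet (T i) := fun i => by
    obtain ⟨F, hF, h⟩ := hcpt i
    rw [h]
    exact MeasurableSet.iUnion fun j => (hF j).measurableSet
  have hPm : ∀ i, MeasurableSet (dropCoord b '' T i) := fun i => by
    obtain ⟨F, hF, h⟩ := hcpt i
    rw [h, Set.image_iUnion]
    exact MeasurableSet.iUnion fun j =>
      ((hF j).image (lipschitzWith_dropCoord b).continuous).measurableSet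
  have hTK : ∀ i, T i ⊆ K := fun i => normalSet_subset hK.isClosed _
  have hfinK : volume (dropCoord b '' K) ≠ ∞ :=
    (hK.image (lipschitzWith_dropCoord b).continuous).measure_lt_top.ne
  have hpiece : ∀ i, ENNReal.ofReal (σ * ⟪b 0, (c i : En (m + 1))⟫_ℝ) * μ (U i)
      ≤ ENNReal.ofReal (θ ^ 2) * (ENNReal.ofReal √m ^ m * volume (dropCoord b '' T i)) := by
    intro i
    rw [hμ _ (hUm i)]
    refine (hloc (c i) (hcO i)).1 _ fun x hx y hy => ?_
    exact abs_inner_sub_le_of_mem_normalSet hK.isClosed (normalSet_mono K (hUC i) hx)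
      (normalSet_mono K (hUC i) hy)
  have hfin : ∀ i, μ (U i) ≠ ∞ := by
    intro i htop
    have h := hpiece i
    have hpos : ENNReal.ofReal (σ * ⟪b 0, (c i : En (m + 1))⟫_ℝ) ≠ 0 :=
      (ENNReal.ofReal_pos.2 (hcO i)).ne'
    rw [htop, ENNReal.mul_top hpos, top_le_iff] at h
    refine ENNReal.mul_ne_top ENNReal.ofReal_ne_top (ENNReal.mul_ne_top
      (ENNReal.pow_ne_top ENNReal.ofReal_ne_top) ?_) h
    exact ne_top_of_le_ne_top hfinK (measure_mono (Set.image_mono (hTK i)))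
  have hdisj : Pairwise (Function.onFun (AEDisjoint volume) fun i => dropCoord b '' T i) := by
    intro i j hij
    have h0 := hausdorffMeasure_normalSet_inter_eq_zero hμ (hUm i) (hUm j)
      (disjoint_disjointed C hij) (hTm j) (hfin i) (hfin j)
    have h1 := (volume_image_dropCoord_le b _).trans h0.le
    refine measure_mono_null ?_ (le_antisymm h1 zero_le)
    rintro _ ⟨⟨x, hx, rfl⟩, ⟨y, hy, hxy⟩⟩
    obtain ⟨-, u, hu, hxu⟩ := id hx
    obtain ⟨-, u', hu', hyu⟩ := id hy
    have := eq_of_dropCoord_eq_of_normal b (hTK i hx) (hTK j hy) hxu hyu (hUpos i u hu)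
      (hUpos j u' hu') hxy.symm
    exact ⟨x, ⟨hx, this ▸ hy⟩, rfl⟩
  have hsum : ∑' i, volume (dropCoord b '' T i) ≤ volume (dropCoord b '' K) := by
    refine (tsum_meas_le_meas_iUnion_of_disjoint₀ volume
      (fun i => (hPm i).nullMeasurableSet) hdisj).trans (measure_mono ?_)
    exact Set.iUnion_subset fun i => Set.image_mono (hTK i)
  have hcover : O ⊆ ⋃ i, U i := by
    rw [hU, iUnion_disjointed]
    simpa using ht
  calc ∫⁻ v : Sph (m + 1), ENNReal.ofReal (σ * ⟪b 0, (v : En (m + 1))⟫_ℝ) ∂μ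
      = ∫⁻ v in ⋃ i, U i, ENNReal.ofReal (σ * ⟪b 0, (v : En (m + 1))⟫_ℝ) ∂μ := by
        rw [← lintegral_indicator (MeasurableSet.iUnion hUm)]
        refine lintegral_congr fun v => ?_
        by_cases hv : v ∈ ⋃ i, U i
        · rw [Set.indicator_of_mem hv]
        · rw [Set.indicator_of_notMem hv]
          exact ENNReal.ofReal_of_nonpos (not_lt.1 fun h => hv (hcover h))
    _ = ∑' i, ∫⁻ v in U i, ENNReal.ofReal (σ * ⟪b 0, (v : En (m + 1))⟫_ℝ) ∂μ :=
        lintegral_iUnion hUm (disjoint_disjointed C) _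
    _ ≤ ∑' i, ENNReal.ofReal (θ ^ 3) *
          (ENNReal.ofReal √m ^ m * volume (dropCoord b '' T i)) := by
        refine ENNReal.tsum_le_tsum fun i => ?_
        calc ∫⁻ v in U i, ENNReal.ofReal (σ * ⟪b 0, (v : En (m + 1))⟫_ℝ) ∂μ
            ≤ ∫⁻ v in U i, ENNReal.ofReal (θ * (σ * ⟪b 0, (c i : En (m + 1))⟫_ℝ)) ∂μ := by
              refine setLIntegral_mono' (hUm i) fun v hv => ENNReal.ofReal_le_ofReal ?_
              exact ((hloc (c i) (hcO i)).2 v (hUC i hv)).2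
          _ = ENNReal.ofReal θ *
                (ENNReal.ofReal (σ * ⟪b 0, (c i : En (m + 1))⟫_ℝ) * μ (U i)) := by
              rw [setLIntegral_const, ENNReal.ofReal_mul hθ0.le, mul_assoc]
          _ ≤ ENNReal.ofReal θ * (ENNReal.ofReal (θ ^ 2) *
                (ENNReal.ofReal √m ^ m * volume (dropCoord b '' T i))) := by
              exact mul_le_mul' le_rfl (hpiece i)
          _ = _ := by
              rw [← mul_assoc, ← ENNReal.ofReal_mul hθ0.le]
              congr 2
              ring
    _ = ENNReal.ofReal (θ ^ 3) *
          (ENNReal.ofReal √m ^ m * ∑' i, volume (dropCoord b '' T i)) := by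
        rw [ENNReal.tsum_mul_left, ENNReal.tsum_mul_left]
    _ ≤ _ := by gcongr

lemma lintegral_ofReal_inner_le {K : Set (En (m + 1))} (hK : IsCompact K)
    {μ : Measure (Sph (m + 1))}
    (hμ : ∀ ω, MeasurableSet ω → μ ω = μH[(m : ℝ)] (normalSet K ω))
    (b : OrthonormalBasis (Fin (m + 1)) ℝ (En (m + 1))) {σ : ℝ} (hσ : |σ| = 1) :
    ∫⁻ v : Sph (m + 1), ENNReal.ofReal (σ * ⟪b 0, (v : En (m + 1))⟫_ℝ) ∂μ
      ≤ ENNReal.ofReal √m ^ m * volume (dropCoord b '' K) := by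
  set A := ENNReal.ofReal √m ^ m * volume (dropCoord b '' K) with hA
  have hfin : A ≠ ∞ := ENNReal.mul_ne_top (ENNReal.pow_ne_top ENNReal.ofReal_ne_top)
    (hK.image (lipschitzWith_dropCoord b).continuous).measure_lt_top.ne
  have hlim : Tendsto (fun θ : ℝ => ENNReal.ofReal (θ ^ 3) * A) (𝓝[>] 1)
      (𝓝 (ENNReal.ofReal (1 ^ 3) * A)) := by
    refine ENNReal.Tendsto.mul_const ?_ (Or.inr hfin)
    exact (ENNReal.continuous_ofReal.comp (continuous_pow 3)).continuousWithinAt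
  rw [one_pow, ENNReal.ofReal_one, one_mul] at hlim
  refine ge_of_tendsto hlim ?_
  filter_upwards [self_mem_nhdsWithin] with θ hθ
  exact lintegral_ofReal_inner_le_mul hK hμ b hσ hθ

/-- The Cauchy projection inequality. -/
lemma lintegral_ofReal_abs_inner_le {K : Set (En (m + 1))} (hK : IsCompact K)
    {μ : Measure (Sph (m + 1))}
    (hμ : ∀ ω, MeasurableSet ω → μ ω = μH[(m : ℝ)] (normalSet K ω))
    (b : OrthonormalBasis (Fin (m + 1)) ℝ (En (m + 1))) :
    ∫⁻ v : Sph (m + 1), ENNReal.ofReal |⟪b 0, (v : En (m + 1))⟫_ℝ| ∂μ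
      ≤ 2 * (ENNReal.ofReal √m ^ m * volume (dropCoord b '' K)) := by
  have h1 := lintegral_ofReal_inner_le hK hμ b (σ := 1) (by simp)
  have h2 := lintegral_ofReal_inner_le hK hμ b (σ := -1) (by simp)
  have hle : ∀ v : Sph (m + 1), ENNReal.ofReal |⟪b 0, (v : En (m + 1))⟫_ℝ|
      ≤ ENNReal.ofReal (1 * ⟪b 0, (v : En (m + 1))⟫_ℝ)
        + ENNReal.ofReal (-1 * ⟪b 0, (v : En (m + 1))⟫_ℝ) := by
    intro v
    rcases abs_choice ⟪b 0, (v : En (m + 1))⟫_ℝ with h | h <;> rw [h] <;> simp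
  calc _ ≤ _ := lintegral_mono hle
    _ = _ := lintegral_add_left (by fun_prop) _
    _ ≤ _ := by rw [two_mul]; exact add_le_add h1 h2

end NormalSet

section Moments

variable {m n : ℕ}

lemma lintegral_ofReal_abs_inner_basis_le {K : Set (En (m + 1))} (hK : IsCompact K)
    {μ : Measure (Sph (m + 1))}
    (hμ : ∀ ω, MeasurableSet ω → μ ω = μH[(m : ℝ)] (normalSet K ω))
    (b : OrthonormalBasis (Fin (m + 1)) ℝ (En (m + 1))) (i : Fin (m + 1)) :
    ∫⁻ v : Sph (m + 1), ENNReal.ofReal |⟪b i, (v : En (m + 1))⟫_ℝ| ∂μ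
      ≤ 2 * (ENNReal.ofReal √m ^ m *
        volume (dropCoord (b.reindex (Equiv.swap 0 i)) '' K)) := by
  have h := lintegral_ofReal_abs_inner_le hK hμ (b.reindex (Equiv.swap 0 i))
  simpa using h

lemma measure_univ_le_sum (b : OrthonormalBasis (Fin n) ℝ (En n)) (μ : Measure (Sph n)) :
    μ Set.univ ≤ ∑ i, ∫⁻ v : Sph n, ENNReal.ofReal |⟪b i, (v : En n)⟫_ℝ| ∂μ := by
  rw [← lintegral_finsetSum _ (fun i _ => by fun_prop), ← lintegral_one]
  refine lintegral_mono fun v => ?_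
  have h1 : ∑ i, ⟪b i, (v : En n)⟫_ℝ ^ 2 = 1 := by
    simpa using b.sum_sq_norm_inner_right (v : En n)
  rw [← ENNReal.ofReal_sum_of_nonneg (fun i _ => abs_nonneg _)]
  refine ENNReal.one_le_ofReal.2 ?_
  rw [← h1]
  refine Finset.sum_le_sum fun i _ => ?_
  have h2 : |⟪b i, (v : En n)⟫_ℝ| ≤ 1 := by
    simpa using abs_real_inner_le_norm (b i) (v : En n)
  rw [← sq_abs]
  nlinarith [abs_nonneg ⟪b i, (v : En n)⟫_ℝ]

lemma isFiniteMeasure_of_eq_normalSet {K : Set (En (m + 1))} (hK : IsCompact K)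
    {μ : Measure (Sph (m + 1))}
    (hμ : ∀ ω, MeasurableSet ω → μ ω = μH[(m : ℝ)] (normalSet K ω)) : IsFiniteMeasure μ := by
  refine ⟨(measure_univ_le_sum (EuclideanSpace.basisFun _ ℝ) μ).trans_lt ?_⟩
  refine ENNReal.sum_lt_top.2 fun i _ =>
    (lintegral_ofReal_abs_inner_basis_le hK hμ _ i).trans_lt ?_
  refine ENNReal.mul_lt_top (by simp) (ENNReal.mul_lt_top
    (ENNReal.pow_lt_top ENNReal.ofReal_lt_top) ?_)
  exact (hK.image (lipschitzWith_dropCoord _).continuous).measure_lt_top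

lemma integrable_of_continuous {μ : Measure (Sph n)} [IsFiniteMeasure μ] {f : Sph n → ℝ}
    (hf : Continuous f) : Integrable f μ :=
  hf.integrable_of_hasCompactSupport (HasCompactSupport.of_compactSpace f)

lemma le_integral_inner_sq {μ : Measure (Sph n)} [IsFiniteMeasure μ] {l : ℝ}
    (hmin : ∀ l' : ℝ, IsEigenvalue (rank2TensorMatrix μ) l' → l ≤ l') {u : En n}
    (hu : ‖u‖ = 1) : 8 * π * l ≤ ∫ v : Sph n, ⟪u, (v : En n)⟫_ℝ ^ 2 ∂μ := by
  have hM : (rank2TensorMatrix μ).IsHermitian := by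
    ext i j
    simp [rank2TensorMatrix, mul_comm]
  have hA : (rank2TensorMatrix μ - l • (1 : Matrix (Fin n) (Fin n) ℝ)).IsHermitian :=
    hM.sub (by ext i j; simp [Matrix.one_apply, eq_comm])
  have hpos := (hA.posSemidef_iff_eigenvalues_nonneg).2 fun j => by
    have h1 := hA.mulVec_eigenvectorBasis j
    have h2 := hmin (hA.eigenvalues j + l) ⟨hA.eigenvectorBasis j, fun h => ?_, ?_⟩
    · simpa using h2
    · refine hA.eigenvectorBasis.toBasis.ne_zero j ?_
      ext i
      simpa using congrFun h i
    · rw [Matrix.sub_mulVec, Matrix.smul_mulVec, Matrix.one_mulVec] at h1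
      rw [add_smul, ← h1, sub_add_cancel]
  have h := hpos.dotProduct_mulVec_nonneg (u : Fin n → ℝ)
  rw [Matrix.sub_mulVec, Matrix.smul_mulVec, Matrix.one_mulVec, dotProduct_sub,
    dotProduct_smul] at h
  have h1 : star (u : Fin n → ℝ) ⬝ᵥ (u : Fin n → ℝ) = 1 := by
    have := EuclideanSpace.real_norm_sq_eq u
    rw [hu] at this
    simp only [dotProduct, Pi.star_apply, star_trivial, ← sq]
    linarith
  have h2 : star (u : Fin n → ℝ) ⬝ᵥ (rank2TensorMatrix μ).mulVec (u : Fin n → ℝ)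
      = (1 / (8 * π)) * ∫ v : Sph n, ⟪u, (v : En n)⟫_ℝ ^ 2 ∂μ := by
    have e : ∀ v : Sph n, ⟪u, (v : En n)⟫_ℝ ^ 2
        = ∑ i, ∑ j, u i * ((v : En n) i * (v : En n) j * u j) := by
      intro v
      rw [PiLp.inner_apply, sq, Finset.sum_mul_sum]
      refine Finset.sum_congr rfl fun i _ => Finset.sum_congr rfl fun j _ => ?_
      simp
      ring
    simp_rw [e]
    rw [integral_finsetSum _ (fun i _ => integrable_of_continuous (by fun_prop)), Finset.mul_sum]
    refine Finset.sum_congr rfl fun i _ => ?_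
    rw [integral_finsetSum _ (fun i _ => integrable_of_continuous (by fun_prop)), Finset.mul_sum]
    simp only [Matrix.mulVec, dotProduct, Pi.star_apply, star_trivial, Finset.mul_sum,
      rank2TensorMatrix, Matrix.of_apply]
    refine Finset.sum_congr rfl fun j _ => ?_
    rw [integral_const_mul, integral_mul_const]
    ring
  rw [h1, h2, smul_eq_mul, mul_one] at h
  have hp := Real.pi_pos
  have h3 := mul_nonneg (by positivity : (0 : ℝ) ≤ 8 * π) h
  rw [mul_sub, ← mul_assoc, mul_one_div_cancel (by positivity), one_mul] at h3
  linarith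

lemma ofReal_le_lintegral_abs_inner {μ : Measure (Sph n)} [IsFiniteMeasure μ] {l : ℝ}
    (hmin : ∀ l' : ℝ, IsEigenvalue (rank2TensorMatrix μ) l' → l ≤ l') {u : En n}
    (hu : ‖u‖ = 1) :
    ENNReal.ofReal (8 * π * l) ≤ ∫⁻ v : Sph n, ENNReal.ofReal |⟪u, (v : En n)⟫_ℝ| ∂μ := by
  refine (ENNReal.ofReal_le_ofReal (le_integral_inner_sq hmin hu)).trans ?_
  rw [ofReal_integral_eq_lintegral_ofReal (integrable_of_continuous (by fun_prop))
    (ae_of_all _ fun v => sq_nonneg _)]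
  refine lintegral_mono fun v => ENNReal.ofReal_le_ofReal ?_
  have h2 : |⟪u, (v : En n)⟫_ℝ| ≤ 1 := by
    simpa [hu] using abs_real_inner_le_norm u (v : En n)
  rw [← sq_abs]
  nlinarith [abs_nonneg ⟪u, (v : En n)⟫_ℝ]

lemma mul_le_measure_univ {μ : Measure (Sph n)} [IsFiniteMeasure μ] {l : ℝ}
    (hmin : ∀ l' : ℝ, IsEigenvalue (rank2TensorMatrix μ) l' → l ≤ l') :
    n * (8 * π * l) ≤ μ.real Set.univ := by
  have h : ∀ v : Sph n, ∑ i, ⟪EuclideanSpace.basisFun (Fin n) ℝ i, (v : En n)⟫_ℝ ^ 2 = 1 := by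
    intro v
    have := (EuclideanSpace.basisFun (Fin n) ℝ).sum_sq_norm_inner_right (v : En n)
    simpa using this
  calc n * (8 * π * l) = ∑ _i : Fin n, 8 * π * l := by simp
    _ ≤ ∑ i, ∫ v : Sph n, ⟪EuclideanSpace.basisFun (Fin n) ℝ i, (v : En n)⟫_ℝ ^ 2 ∂μ :=
        Finset.sum_le_sum fun i _ => le_integral_inner_sq hmin
          ((EuclideanSpace.basisFun (Fin n) ℝ).norm_eq_one i)
    _ = μ.real Set.univ := by
        rw [← integral_finsetSum _ (fun i _ => integrable_of_continuous (by fun_prop))]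
        simp_rw [h]
        simp

end Moments

section UnitSphere

variable {m : ℕ}

lemma sphLebesgue_eq_normalSet_closedBall (ω : Set (Sph (m + 1))) :
    sphLebesgue (m + 1) ω = μH[(m : ℝ)] (normalSet (closedBall 0 1) ω) := by
  have h : normalSet (closedBall (0 : En (m + 1)) 1) ω = Subtype.val '' ω := by
    ext x
    simp only [normalSet, frontier_closedBall (0 : En (m + 1)) one_ne_zero, Set.mem_ofPred_eq,
      Set.mem_image]
    constructor
    · rintro ⟨hx, u, hu, h⟩
      refine ⟨u, hu, ?_⟩
      have h1 := h u (sphere_subset_closedBall u.2)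
      have hx1 : ‖x‖ = 1 := by simpa using hx
      have hu1 : ‖(u : En (m + 1))‖ = 1 := by simp
      rw [inner_sub_left, real_inner_self_eq_norm_sq, hu1] at h1
      have h2 := norm_sub_sq_real (u : En (m + 1)) x
      rw [hx1, hu1, real_inner_comm] at h2
      have h3 : ‖(u : En (m + 1)) - x‖ ^ 2 ≤ 0 := by linarith
      have h4 : ‖(u : En (m + 1)) - x‖ = 0 := by
        nlinarith [norm_nonneg ((u : En (m + 1)) - x)]
      exact sub_eq_zero.1 (norm_eq_zero.1 h4)
    · rintro ⟨u, hu, rfl⟩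
      refine ⟨u.2, u, hu, fun y hy => ?_⟩
      have hu1 : ‖(u : En (m + 1))‖ = 1 := by simp
      have hy1 : ‖y‖ ≤ 1 := by simpa using hy
      have := real_inner_le_norm y (u : En (m + 1))
      rw [inner_sub_left, real_inner_self_eq_norm_sq, hu1]
      rw [hu1] at this
      linarith
  rw [h, sphLebesgue]
  have := (isometry_subtype_coe (s := Sph (m + 1))).hausdorffMeasure_image (d := (m : ℝ))
    (Or.inl (by positivity)) ω
  rw [this]
  congr 2
  push_cast
  ring

lemma omegaN_le : omegaN (m + 1) ≤ (m + 1) * (2 * (√m ^ m * 2 ^ m)) := by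
  have hvol : ∀ b : OrthonormalBasis (Fin (m + 1)) ℝ (En (m + 1)),
      volume (dropCoord b '' closedBall 0 1) ≤ 2 ^ m := by
    intro b
    refine (Real.volume_pi_le_diam_pow _).trans ?_
    rw [Fintype.card_fin]
    gcongr
    have h1 := (lipschitzWith_dropCoord b).ediam_image_le (closedBall 0 1)
    refine h1.trans ?_
    have h2 := ediam_closedEBall_le (x := (0 : En (m + 1))) (r := 1)
    rw [← ENNReal.ofReal_one, closedEBall_ofReal zero_le_one] at h2
    simpa using h2
  have h : sphLebesgue (m + 1) Set.univ
      ≤ ENNReal.ofReal ((m + 1) * (2 * (√m ^ m * 2 ^ m))) := by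
    refine (measure_univ_le_sum (EuclideanSpace.basisFun _ ℝ) _).trans ?_
    calc _ ≤ ∑ _i : Fin (m + 1), 2 * (ENNReal.ofReal √m ^ m * 2 ^ m) := by
          refine Finset.sum_le_sum fun i _ => ?_
          refine (lintegral_ofReal_abs_inner_basis_le (isCompact_closedBall 0 1)
            (fun ω _ => sphLebesgue_eq_normalSet_closedBall ω) _ i).trans ?_
          gcongr
          exact hvol _
      _ = _ := by
          rw [ENNReal.ofReal_mul (by positivity), ENNReal.ofReal_mul (by positivity),
            ENNReal.ofReal_mul (by positivity), ENNReal.ofReal_pow (by positivity),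
            ENNReal.ofReal_pow (by positivity), ENNReal.ofReal_ofNat]
          have : ENNReal.ofReal ((m : ℝ) + 1) = (m + 1 : ℕ) := by
            rw [← ENNReal.ofReal_natCast]; push_cast; rfl
          rw [this]
          simp
  exact ENNReal.toReal_le_of_le_ofReal (by positivity) h

end UnitSphere

section Support

variable {m n : ℕ}

lemma exists_unit_normal {K : Set (En n)} (hconv : Convex ℝ K) (hint : (interior K).Nonempty)
    {y : En n} (hy : y ∉ interior K) :
    ∃ u : Sph n, ∀ z ∈ K, ⟪z - y, (u : En n)⟫_ℝ ≤ 0 := by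
  obtain ⟨f, hf⟩ := geometric_hahn_banach_open_point hconv.interior isOpen_interior hy
  obtain ⟨w, rfl⟩ := (InnerProductSpace.toDual ℝ (En n)).surjective f
  simp only [InnerProductSpace.toDual_apply_apply] at hf
  have hw : w ≠ 0 := by
    rintro rfl
    obtain ⟨a, ha⟩ := hint
    simpa using hf a ha
  have hcl : ∀ z ∈ K, ⟪w, z⟫_ℝ ≤ ⟪w, y⟫_ℝ := by
    intro z hz
    have h1 : z ∈ closure (interior K) := by
      rw [hconv.closure_interior_eq_closure_of_nonempty_interior hint]
      exact subset_closure hz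
    have h2 : closure (interior K) ⊆ {z | ⟪w, z⟫_ℝ ≤ ⟪w, y⟫_ℝ} :=
      closure_minimal (fun a ha => (hf a ha).le) (isClosed_le (by fun_prop) continuous_const)
    exact h2 h1
  refine ⟨⟨‖w‖⁻¹ • w, ?_⟩, fun z hz => ?_⟩
  · simp [norm_smul, hw]
  · rw [inner_smul_right, inner_sub_left, real_inner_comm, real_inner_comm w y]
    exact mul_nonpos_of_nonneg_of_nonpos (by positivity) (by linarith [hcl z hz])

lemma volume_image_dropCoord_le_normalSet {K : Set (En (m + 1))} (hconv : Convex ℝ K)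
    (hcomp : IsCompact K) (hint : (interior K).Nonempty)
    (b : OrthonormalBasis (Fin (m + 1)) ℝ (En (m + 1))) :
    volume (dropCoord b '' K) ≤ μH[(m : ℝ)] (normalSet K Set.univ) := by
  refine (measure_mono ?_).trans (volume_image_dropCoord_le b _)
  rintro _ ⟨x, hx, rfl⟩
  have hF : IsCompact (K ∩ {y | dropCoord b y = dropCoord b x}) :=
    hcomp.inter_right (isClosed_eq (lipschitzWith_dropCoord b).continuous continuous_const)
  obtain ⟨y, ⟨hyK, hyx⟩, hmax⟩ := hF.exists_isMaxOn ⟨x, hx, rfl⟩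
    (f := fun y => ⟪b 0, y⟫_ℝ) (by fun_prop)
  have hyx : dropCoord b y = dropCoord b x := hyx
  have hy : y ∉ interior K := by
    intro h
    have hc : Tendsto (fun t : ℝ => y + t • b 0) (𝓝[>] 0) (𝓝 (y + (0 : ℝ) • b 0)) :=
      (Continuous.tendsto (by fun_prop) 0).mono_left nhdsWithin_le_nhds
    rw [zero_smul, add_zero] at hc
    obtain ⟨t, ht, ht0⟩ :=
      ((hc.eventually (mem_interior_iff_mem_nhds.1 h)).and self_mem_nhdsWithin).exists
    have ht0 : 0 < t := ht0
    have hd : dropCoord b (y + t • b 0) = dropCoord b x := by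
      rw [← hyx]
      ext i
      simp [dropCoord]
    have hle : ⟪b 0, y + t • b 0⟫_ℝ ≤ ⟪b 0, y⟫_ℝ := hmax ⟨ht, hd⟩
    rw [inner_add_right, inner_smul_right, b.inner_eq_one] at hle
    linarith
  obtain ⟨u, hu⟩ := exists_unit_normal hconv hint hy
  exact ⟨y, ⟨⟨subset_closure hyK, hy⟩, u, Set.mem_univ _, hu⟩, hyx⟩

lemma closedBall_subset_of_support {K : Set (En n)} (hconv : Convex ℝ K) (hclosed : IsClosed K)
    (hne : K.Nonempty) {r : ℝ} (h : ∀ v : En n, ‖v‖ = 1 → ∃ x ∈ K, r ≤ ⟪x, v⟫_ℝ) :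
    closedBall 0 r ⊆ K := by
  intro z hz
  by_contra hzK
  obtain ⟨f, c, hf, hc⟩ := geometric_hahn_banach_closed_point hconv hclosed hzK
  obtain ⟨w, rfl⟩ := (InnerProductSpace.toDual ℝ (En n)).surjective f
  simp only [InnerProductSpace.toDual_apply_apply] at hf hc
  have hw : w ≠ 0 := by
    rintro rfl
    obtain ⟨a, ha⟩ := hne
    have := hf a ha
    simp only [inner_zero_left] at this hc
    linarith
  have hw0 : 0 < ‖w‖ := norm_pos_iff.2 hw
  obtain ⟨x, hx, hrx⟩ := h (‖w‖⁻¹ • w) (by simp [norm_smul, hw])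
  have hz' : ‖z‖ ≤ r := by simpa using hz
  have h1 := hf x hx
  have h2 := real_inner_le_norm w z
  rw [inner_smul_right, real_inner_comm, inv_mul_eq_div, le_div_iff₀ hw0] at hrx
  nlinarith

lemma centroid_support_le {K : Set (En n)} (hconv : Convex ℝ K) (hcomp : IsCompact K)
    (hint : (interior K).Nonempty) (hcent : (∫ x in K, x) = 0) {v p q : En n} (hp : p ∈ K)
    (hqv : ∀ x ∈ K, ⟪v, x⟫_ℝ ≤ ⟪v, q⟫_ℝ) :
    ⟪v, q - p⟫_ℝ ≤ (n + 1) * ⟪v, q⟫_ℝ := by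
  have hfin : volume K ≠ ∞ := hcomp.measure_lt_top.ne
  have hV : 0 < volume.real K :=
    ENNReal.toReal_pos (Measure.measure_pos_of_nonempty_interior volume hint).ne' hfin
  have hconst : ∀ c : ℝ, Integrable (fun _ : En n => c) (volume.restrict K) :=
    fun c => integrableOn_const hfin
  set f : En n → ℝ := fun x => ⟪v, q - x⟫_ℝ with hf
  have hfc : Continuous f := by fun_prop
  have hfi : ∀ T ⊆ K, IntegrableOn f T := fun T hT =>
    (hfc.continuousOn.integrableOn_compact hcomp).mono_set hT
  have hI : ∫ x in K, f x = ⟪v, q⟫_ℝ * volume.real K := by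
    have hid : IntegrableOn (fun x : En n => x) K := continuousOn_id.integrableOn_compact hcomp
    have h1 : ∫ x in K, ⟪v, x⟫_ℝ = 0 := by
      rw [integral_inner hid v, hcent, inner_zero_right]
    simp only [hf, inner_sub_right]
    rw [integral_sub (hconst _) (hid.const_inner v), h1, setIntegral_const]
    simp [mul_comm]
  have key : ∀ t : ℝ, 0 < t → t < 1 →
      t ^ n * (⟪v, q - p⟫_ℝ * volume.real K)
        ≤ (∑ i ∈ Finset.range (n + 1), t ^ i) * ∫ x in K, f x := by
    intro t ht0 ht1
    set g : En n → En n := fun x => p + t • (x - p) with hg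
    have hsub : g '' K ⊆ K := by
      rintro _ ⟨x, hx, rfl⟩
      have := hconv hp hx (sub_nonneg.2 ht1.le) ht0.le (by ring)
      convert this using 1
      simp only [hg]
      module
    have hder : ∀ x ∈ K, HasFDerivWithinAt g (t • ContinuousLinearMap.id ℝ (En n)) K x := by
      intro x _
      have := (((hasFDerivAt_id (𝕜 := ℝ) x).sub_const p).const_smul t).const_add p
      exact this.hasFDerivWithinAt
    have hinj : Set.InjOn g K := fun x _ y _ hxy => by
      have h1 := smul_right_injective (En n) ht0.ne' (add_left_cancel hxy)
      exact sub_left_injective h1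
    have h1 := integral_image_eq_integral_abs_det_fderiv_smul volume hcomp.measurableSet hder
      hinj f
    have hdet : |(t • ContinuousLinearMap.id ℝ (En n)).det| = t ^ n := by
      have : ((t • ContinuousLinearMap.id ℝ (En n) : En n →L[ℝ] En n) : En n →ₗ[ℝ] En n)
          = t • LinearMap.id := rfl
      rw [ContinuousLinearMap.det, this, LinearMap.det_smul, LinearMap.det_id]
      simp [abs_of_pos ht0]
    have hfg : ∀ x, f (g x) = (1 - t) * ⟪v, q - p⟫_ℝ + t * f x := by
      intro x
      simp only [hf, hg, inner_sub_right, inner_add_right, inner_smul_right]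
      ring
    simp only [hdet, hfg, smul_eq_mul] at h1
    rw [integral_const_mul, integral_add (hconst _) ((hfi K subset_rfl).const_mul t),
      setIntegral_const, integral_const_mul, smul_eq_mul] at h1
    have h2 : ∫ x in g '' K, f x ≤ ∫ x in K, f x := by
      refine setIntegral_mono_set (hfi K subset_rfl) ?_ (Eventually.of_forall hsub)
      refine (ae_restrict_iff' hcomp.measurableSet).2 (ae_of_all _ fun x hx => ?_)
      simp only [hf, Pi.zero_apply, inner_sub_right]
      linarith [hqv x hx]
    rw [h1] at h2
    have h3 := mul_neg_geom_sum t (n + 1)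
    set I := ∫ x in K, f x
    have h4 : 0 ≤ (1 - t) * ((∑ i ∈ Finset.range (n + 1), t ^ i) * I
        - t ^ n * (⟪v, q - p⟫_ℝ * volume.real K)) := by
      have : (1 - t) * ((∑ i ∈ Finset.range (n + 1), t ^ i) * I) = (1 - t ^ (n + 1)) * I := by
        rw [← h3]; ring
      rw [mul_sub, this, pow_succ]
      nlinarith
    have h5 := nonneg_of_mul_nonneg_right h4 (by linarith)
    linarith
  have hlim1 : Tendsto (fun t : ℝ => t ^ n * (⟪v, q - p⟫_ℝ * volume.real K)) (𝓝[<] 1)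
      (𝓝 (1 ^ n * (⟪v, q - p⟫_ℝ * volume.real K))) :=
    (Continuous.tendsto (by fun_prop) 1).mono_left nhdsWithin_le_nhds
  have hlim2 : Tendsto (fun t : ℝ => (∑ i ∈ Finset.range (n + 1), t ^ i) * ∫ x in K, f x) (𝓝[<] 1)
      (𝓝 ((∑ i ∈ Finset.range (n + 1), 1 ^ i) * ∫ x in K, f x)) :=
    (Continuous.tendsto (by fun_prop) 1).mono_left nhdsWithin_le_nhds
  have hle := le_of_tendsto_of_tendsto hlim1 hlim2 (by
    filter_upwards [Ioo_mem_nhdsLT (zero_lt_one' ℝ)] with t ht using key t ht.1 ht.2)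
  rw [hI] at hle
  simp only [one_pow, one_mul, Finset.sum_const, Finset.card_range, nsmul_eq_mul, mul_one,
    ← mul_assoc] at hle
  have := le_of_mul_le_mul_right hle hV
  push_cast at this
  exact this

end Support

section Width

variable {k : ℕ}

lemma volume_le_width_mul_volume_tail {L : Set (Fin (k + 1) → ℝ)} {w : ℝ}
    (hL : ∀ x ∈ L, ∀ y ∈ L, x 0 - y 0 ≤ w) (hc : IsCompact L) :
    volume L ≤ ENNReal.ofReal w * volume (Fin.tail '' L) := by
  rcases L.eq_empty_or_nonempty with rfl | hne
  · simp
  obtain ⟨y, hy, hmin⟩ := hc.exists_isMinOn hne (f := fun x => x 0) (by fun_prop)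
  have h := volume_tail_mem_inter_zero_mem (Fin.tail '' L) (Set.Icc (y 0) (y 0 + w))
  rw [Real.volume_Icc, add_sub_cancel_left] at h
  rw [← h]
  refine measure_mono fun x hx => ⟨⟨hmin hx, ?_⟩, x, hx, rfl⟩
  linarith [hL x hx y hy]

lemma mul_volume_tail_le {L : Set (Fin (k + 1) → ℝ)} (hconv : Convex ℝ L) (hc : IsCompact L)
    {P Q : Fin (k + 1) → ℝ} (hP : P ∈ L) (hQ : Q ∈ L) (htail : Fin.tail P = Fin.tail Q) {D : ℝ}
    (hD : 0 ≤ D) (hPQ : Q 0 - P 0 = D) :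
    ENNReal.ofReal D * volume (Fin.tail '' L) ≤ 2 ^ (k + 1) * volume L := by
  have htc : Continuous (Fin.tail : (Fin (k + 1) → ℝ) → Fin k → ℝ) :=
    continuous_pi fun i => continuous_apply i.succ
  set M := Fin.tail '' L with hM
  set M' := AffineMap.homothety (Fin.tail P) (1 / 2 : ℝ) '' M with hM'
  have hM'm : MeasurableSet M' :=
    ((hc.image htc).image (AffineMap.homothety_continuous _ _)).measurableSet
  have hvol : volume M' = (2⁻¹ : ℝ≥0∞) ^ k * volume M := by
    rw [hM', Measure.addHaar_image_homothety, Module.finrank_fin_fun, abs_of_pos (by positivity),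
      ENNReal.ofReal_pow (by positivity), one_div, ENNReal.ofReal_inv_of_pos two_pos,
      ENNReal.ofReal_ofNat]
  have hpres := (volume_preserving_piFinSuccAbove (fun _ : Fin (k + 1) => ℝ) 0).symm
  have hprod := hpres.measure_preimage_equiv L
  rw [← hprod, Measure.volume_eq_prod,
    Measure.prod_apply_symm (hpres.measurable hc.measurableSet)]
  have hfib : ∀ z ∈ M', ENNReal.ofReal (D / 2) ≤ volume ((fun x : ℝ => (x, z)) ⁻¹'
      ((MeasurableEquiv.piFinSuccAbove (fun _ : Fin (k + 1) => ℝ) 0).symm ⁻¹' L)) := by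
    rintro _ ⟨_, ⟨x, hx, rfl⟩, rfl⟩
    have hI := Real.volume_Icc (a := (x 0 + P 0) / 2) (b := (x 0 + P 0) / 2 + D / 2)
    rw [add_sub_cancel_left] at hI
    rw [← hI]
    refine measure_mono fun s hs => ?_
    change (MeasurableEquiv.piFinSuccAbove (fun _ : Fin (k + 1) => ℝ) 0).symm (s, _) ∈ L
    rcases hD.eq_or_lt with hD0 | hD0
    · have h1 := hconv hx hP (by norm_num : (0 : ℝ) ≤ 1 / 2) (by norm_num : (0 : ℝ) ≤ 1 / 2)
        (by norm_num)
      convert h1 using 1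
      have hs' : s = (x 0 + P 0) / 2 := by
        rw [← hD0] at hs
        exact le_antisymm (by linarith [hs.2]) hs.1
      ext i
      refine Fin.cases ?_ (fun j => ?_) i
      · simp [MeasurableEquiv.piFinSuccAbove, hs']
        ring
      · simp [MeasurableEquiv.piFinSuccAbove, AffineMap.homothety_apply, Fin.tail]
        ring
    · set c := (s - (x 0 + P 0) / 2) / D with hc'
      have hc0 : 0 ≤ c := div_nonneg (by linarith [hs.1]) hD
      have hc1 : 0 ≤ 1 / 2 - c := by
        rw [hc', sub_nonneg, div_le_iff₀ hD0]
        linarith [hs.2]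
      have hcD : c * D = s - (x 0 + P 0) / 2 := div_mul_cancel₀ _ hD0.ne'
      have h1 := hconv.sum_mem (t := Finset.univ) (w := ![1 / 2, 1 / 2 - c, c]) (z := ![x, P, Q])
        (by intro i _; fin_cases i <;> simp <;> linarith)
        (by simp [Fin.sum_univ_three]; ring) (by intro i _; fin_cases i <;> simp [hx, hP, hQ])
      convert h1 using 1
      ext i
      refine Fin.cases ?_ (fun j => ?_) i
      · simp [MeasurableEquiv.piFinSuccAbove, Fin.sum_univ_three]
        linear_combination (-1 : ℝ) * hcD - c * hPQ
      · have ht : P j.succ = Q j.succ := congrFun htail j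
        simp [MeasurableEquiv.piFinSuccAbove, AffineMap.homothety_apply, Fin.sum_univ_three,
          Fin.tail, ← ht]
        ring
  have hle : ENNReal.ofReal (D / 2) * volume M' ≤ ∫⁻ z, volume ((fun x : ℝ => (x, z)) ⁻¹'
      ((MeasurableEquiv.piFinSuccAbove (fun _ : Fin (k + 1) => ℝ) 0).symm ⁻¹' L)) := by
    rw [← setLIntegral_const]
    exact (setLIntegral_mono' hM'm hfib).trans (setLIntegral_le_lintegral _ _)
  rw [hvol] at hle
  calc ENNReal.ofReal D * volume M
      = 2 ^ (k + 1) * (ENNReal.ofReal (D / 2) * ((2⁻¹ : ℝ≥0∞) ^ k * volume M)) := by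
        have h2 : (2 : ℝ≥0∞) ^ k * 2⁻¹ ^ k = 1 := by
          rw [← mul_pow, ENNReal.mul_inv_cancel (by simp) (by simp), one_pow]
        have h3 : ENNReal.ofReal D = 2 * ENNReal.ofReal (D / 2) := by
          rw [← ENNReal.ofReal_ofNat, ← ENNReal.ofReal_mul (by norm_num)]
          congr 1
          ring
        calc ENNReal.ofReal D * volume M
            = 2 * ENNReal.ofReal (D / 2) * volume M * (2 ^ k * 2⁻¹ ^ k) := by
              rw [h2, h3, mul_one]
          _ = _ := by ring
    _ ≤ _ := mul_le_mul' le_rfl hle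

lemma exists_orthonormalBasis_zero_one_eq {v u : En (k + 2)} (hv : ‖v‖ = 1) (hu : ‖u‖ = 1)
    (hvu : ⟪v, u⟫_ℝ = 0) :
    ∃ b : OrthonormalBasis (Fin (k + 2)) ℝ (En (k + 2)), b 0 = v ∧ b 1 = u := by
  have h : Orthonormal ℝ (({0, 1} : Set (Fin (k + 2))).domRestrict
      (fun i => if i = 0 then v else u)) := by
    constructor
    · rintro ⟨i, rfl | rfl⟩ <;> simp [hv, hu]
    · rintro ⟨i, rfl | rfl⟩ ⟨j, rfl | rfl⟩ hij <;>
        simp_all [real_inner_comm]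
  obtain ⟨b, hb⟩ := h.exists_orthonormalBasis_extension_of_card_eq (by simp)
  exact ⟨b, by simpa using hb 0 (by simp), by simpa using hb 1 (by simp)⟩

lemma tail_dropCoord_reindex_swap (b : OrthonormalBasis (Fin (k + 2)) ℝ (En (k + 2)))
    (x : En (k + 2)) :
    Fin.tail (dropCoord (b.reindex (Equiv.swap 0 1)) x) = Fin.tail (dropCoord b x) := by
  ext i
  simp only [Fin.tail, dropCoord, OrthonormalBasis.repr_apply_apply,
    OrthonormalBasis.reindex_apply, Equiv.symm_swap]
  rw [Equiv.swap_apply_of_ne_of_ne (Fin.succ_ne_zero _)]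
  exact fun h => Fin.succ_ne_zero i (Fin.succ_injective _ h)

lemma dropCoord_basis_zero {m : ℕ} (b : OrthonormalBasis (Fin (m + 1)) ℝ (En (m + 1))) :
    dropCoord b (b 0) = 0 := by
  ext i
  simp [dropCoord]

lemma convex_image_dropCoord {m : ℕ} (b : OrthonormalBasis (Fin (m + 1)) ℝ (En (m + 1)))
    {K : Set (En (m + 1))} (hK : Convex ℝ K) : Convex ℝ (dropCoord b '' K) := by
  rintro _ ⟨x, hx, rfl⟩ _ ⟨y, hy, rfl⟩ s t hs ht hst
  refine ⟨s • x + t • y, hK hx hy hs ht hst, ?_⟩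
  ext i
  simp [dropCoord]

/-- A hyperplane shadow seen from a direction orthogonal to `v` is bounded by the width in the
direction `v` times the content of a shadow of codimension two, which the shadows along `v`
control. -/
lemma exists_volume_image_dropCoord_le_width_mul {K : Set (En (k + 2))} (hconv : Convex ℝ K)
    (hcomp : IsCompact K) (hint : (interior K).Nonempty) {S : ℝ} (hS : 0 ≤ S)
    (hshadow : ∀ b : OrthonormalBasis (Fin (k + 2)) ℝ (En (k + 2)),
      volume (dropCoord b '' K) ≤ ENNReal.ofReal S)
    {v : En (k + 2)} (hv : ‖v‖ = 1) {w : ℝ} (hw : ∀ x ∈ K, ∀ y ∈ K, ⟪v, x - y⟫_ℝ ≤ w) :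
    ∃ (b : OrthonormalBasis (Fin (k + 2)) ℝ (En (k + 2))) (V : ℝ), 0 ≤ V ∧
      volume (dropCoord b '' K) ≤ ENNReal.ofReal w * ENNReal.ofReal V ∧
      V ^ (k + 1) ≤ (2 ^ (k + 1) * S) ^ k := by
  have hKne : K.Nonempty := hint.mono interior_subset
  obtain ⟨p, hp, q, hq, hmax⟩ : ∃ p ∈ K, ∃ q ∈ K, ∀ x ∈ K, ∀ y ∈ K,
      ‖(x - y) - ⟪v, x - y⟫_ℝ • v‖ ≤ ‖(p - q) - ⟪v, p - q⟫_ℝ • v‖ := by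
    obtain ⟨z, hz, hmax⟩ := (hcomp.prod hcomp).exists_isMaxOn (hKne.prod hKne)
      (f := fun z : En (k + 2) × En (k + 2) => ‖(z.1 - z.2) - ⟪v, z.1 - z.2⟫_ℝ • v‖)
      (by fun_prop)
    exact ⟨z.1, hz.1, z.2, hz.2, fun x hx y hy => isMaxOn_iff.1 hmax (x, y) ⟨hx, hy⟩⟩
  obtain ⟨d, hd⟩ : ∃ d, d = p - q := ⟨_, rfl⟩
  obtain ⟨D, hDdef⟩ : ∃ D, D = ‖d - ⟪v, d⟫_ℝ • v‖ := ⟨_, rfl⟩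
  have hmax' : ∀ x ∈ K, ∀ y ∈ K, ‖(x - y) - ⟪v, x - y⟫_ℝ • v‖ ≤ D := by
    rw [hDdef, hd]
    exact hmax
  have hD : 0 < D := by
    obtain ⟨b, rfl⟩ := exists_orthonormalBasis_zero_eq v hv
    obtain ⟨x, hx⟩ := hint
    have hc : Tendsto (fun t : ℝ => x + t • b 1) (𝓝[>] 0) (𝓝 (x + (0 : ℝ) • b 1)) :=
      (Continuous.tendsto (by fun_prop) 0).mono_left nhdsWithin_le_nhds
    rw [zero_smul, add_zero] at hc
    obtain ⟨t, ht, ht0⟩ :=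
      ((hc.eventually (mem_interior_iff_mem_nhds.1 hx)).and self_mem_nhdsWithin).exists
    have ht0 : 0 < t := ht0
    have h := hmax' _ ht _ (interior_subset hx)
    rw [add_sub_cancel_left, inner_smul_right, b.inner_eq_zero (by simp), mul_zero, zero_smul,
      sub_zero, norm_smul, b.norm_eq_one, mul_one, Real.norm_eq_abs, abs_of_pos ht0] at h
    linarith
  have hvv : ⟪v, v⟫_ℝ = 1 := by rw [real_inner_self_eq_norm_sq, hv, one_pow]
  obtain ⟨b, hb0, hb1⟩ := exists_orthonormalBasis_zero_one_eq
    (v := v) (u := D⁻¹ • (d - ⟪v, d⟫_ℝ • v)) hv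
    (by rw [norm_smul, ← hDdef, Real.norm_eq_abs, abs_of_pos (by positivity),
          inv_mul_cancel₀ hD.ne'])
    (by rw [inner_smul_right, inner_sub_right, inner_smul_right, hvv]; ring)
  have hdec : d = ⟪v, d⟫_ℝ • b 0 + D • b 1 := by
    rw [hb0, hb1, smul_smul, mul_inv_cancel₀ hD.ne', one_smul]
    abel
  have hdd : dropCoord b p - dropCoord b q = dropCoord b (D • b 1) := by
    rw [← dropCoord_sub, ← hd, hdec]
    ext i
    simp [dropCoord]
  set L := dropCoord b '' K with hL
  have hLc : IsCompact L := hcomp.image (lipschitzWith_dropCoord b).continuous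
  have htc : Continuous (Fin.tail : (Fin (k + 1) → ℝ) → Fin k → ℝ) :=
    continuous_pi fun i => continuous_apply i.succ
  have hfin : volume (Fin.tail '' L) ≠ ∞ := (hLc.image htc).measure_lt_top.ne
  have hchord := mul_volume_tail_le (convex_image_dropCoord b hconv) hLc (P := dropCoord b q)
    (Q := dropCoord b p) ⟨q, hq, rfl⟩ ⟨p, hp, rfl⟩ (by
      ext i
      have := congrFun hdd i.succ
      simp only [Pi.sub_apply, dropCoord_smul, Pi.smul_apply, smul_eq_mul] at this
      have h0 : dropCoord b (b 1) i.succ = 0 := by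
        rw [dropCoord, b.repr_self, PiLp.single_apply, if_neg]
        exact fun h => Fin.succ_ne_zero i (Fin.succ_injective _ h)
      rw [h0, mul_zero, sub_eq_zero] at this
      exact this.symm) hD.le (by
      have := congrFun hdd 0
      simp only [Pi.sub_apply, dropCoord_smul, Pi.smul_apply, smul_eq_mul] at this
      have h0 : dropCoord b (b 1) 0 = 1 := by
        rw [dropCoord, b.repr_self, PiLp.single_apply, if_pos]
        rfl
      rw [this, h0, mul_one])
  have hdiam : volume (Fin.tail '' L) ≤ ENNReal.ofReal D ^ k := by
    refine (Real.volume_pi_le_diam_pow _).trans ?_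
    rw [Fintype.card_fin]
    gcongr
    refine ediam_le ?_
    rintro _ ⟨_, ⟨x, hx, rfl⟩, rfl⟩ _ ⟨_, ⟨y, hy, rfl⟩, rfl⟩
    rw [edist_dist]
    refine ENNReal.ofReal_le_ofReal ?_
    rw [dist_eq_norm]
    refine (pi_norm_le_iff_of_nonneg hD.le).2 fun i => ?_
    have h1 := norm_le_pi_norm (dropCoord b ((x - y) - ⟪v, x - y⟫_ℝ • v)) i.succ
    have h2 := norm_dropCoord_le b ((x - y) - ⟪v, x - y⟫_ℝ • v)
    have h3 : dropCoord b ((x - y) - ⟪v, x - y⟫_ℝ • v) = dropCoord b x - dropCoord b y := by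
      rw [dropCoord_sub, dropCoord_smul, ← hb0, dropCoord_basis_zero, smul_zero, sub_zero,
        dropCoord_sub]
    have h4 := hmax' x hx y hy
    rw [h3] at h1 h2
    exact h1.trans (h2.trans h4)
  refine ⟨b.reindex (Equiv.swap 0 1), (volume (Fin.tail '' L)).toReal, ENNReal.toReal_nonneg,
    ?_, ?_⟩
  · rw [ENNReal.ofReal_toReal hfin]
    have h1 := volume_le_width_mul_volume_tail
      (L := dropCoord (b.reindex (Equiv.swap 0 1)) '' K) (w := w) (by
        rintro _ ⟨x, hx, rfl⟩ _ ⟨y, hy, rfl⟩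
        have h2 : ∀ z, dropCoord (b.reindex (Equiv.swap 0 1)) z 0 = ⟪v, z⟫_ℝ := by
          intro z
          simp [dropCoord, OrthonormalBasis.repr_apply_apply, hb0]
        rw [h2, h2, ← inner_sub_right]
        exact hw x hx y hy) (hcomp.image (lipschitzWith_dropCoord _).continuous)
    rw [Set.image_image] at h1
    simp only [tail_dropCoord_reindex_swap] at h1
    rw [← Set.image_image (g := Fin.tail) (f := dropCoord b)] at h1
    exact h1
  · set V := (volume (Fin.tail '' L)).toReal
    have h1 : V ≤ D ^ k := by
      refine ENNReal.toReal_le_of_le_ofReal (by positivity) ?_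
      rw [ENNReal.ofReal_pow hD.le]
      exact hdiam
    have h2 : D * V ≤ 2 ^ (k + 1) * S := by
      have h3 := hchord.trans (mul_le_mul' le_rfl (hshadow b))
      rw [← ENNReal.ofReal_toReal hfin, ← ENNReal.ofReal_mul hD.le,
        ← ENNReal.ofReal_ofNat 2, ← ENNReal.ofReal_pow (by positivity),
        ← ENNReal.ofReal_mul (by positivity)] at h3
      exact (ENNReal.ofReal_le_ofReal_iff (by positivity)).1 h3
    have hV0 : 0 ≤ V := ENNReal.toReal_nonneg
    calc V ^ (k + 1) = V * V ^ k := by ring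
      _ ≤ D ^ k * V ^ k := by gcongr
      _ = (D * V) ^ k := by ring
      _ ≤ _ := by gcongr

end Width

section Estimates

lemma mul_succ_le_two_pow {m : ℕ} (hm : 1 ≤ m) : m * (m + 1) ≤ 2 ^ (m + 1) := by
  rcases hm.eq_or_lt with rfl | h
  · norm_num
  induction m, (h : 2 ≤ m) using Nat.le_induction with
  | base => norm_num
  | succ j hj ih =>
    have := ih (by omega)
    rw [pow_succ]
    nlinarith

lemma sqrt_pow_self_le (k : ℕ) :
    √((k + 1 : ℕ) : ℝ) ^ (k + 1) ≤ ((k + 1 : ℕ) : ℝ) ^ k := by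
  rcases Nat.eq_zero_or_pos k with rfl | hk
  · simp
  refine abs_le_of_sq_le_sq' ?_ (by positivity) |>.2
  rw [← pow_mul, mul_comm, pow_mul, Real.sq_sqrt (by positivity), ← pow_mul]
  exact pow_le_pow_right₀ (by exact_mod_cast Nat.le_add_left 1 k) (by omega)

lemma two_mul_pow_self_le (m : ℕ) (hm : 0 < m) : 2 * (m : ℝ) ^ m ≤ ((m : ℝ) + 1) ^ m := by
  have hm' : (0 : ℝ) < m := by exact_mod_cast hm
  have h := one_add_mul_le_pow (a := 1 / (m : ℝ)) (by
    have : 0 < 1 / (m : ℝ) := by positivity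
    linarith) m
  rw [mul_one_div_cancel hm'.ne'] at h
  calc 2 * (m : ℝ) ^ m ≤ (1 + 1 / (m : ℝ)) ^ m * (m : ℝ) ^ m := by gcongr; linarith
    _ = _ := by rw [← mul_pow]; congr 1; field_simp

lemma sqrt_pow_mul_two_pow_mul_pow_le {k m : ℕ} (hm : m = k + 1) {ω ρ : ℝ} (hω : 0 ≤ ω)
    (hω' : ω ≤ (m + 1) * (2 * (√m ^ m * 2 ^ m))) (hρ : (m : ℝ) + 1 ≤ ρ) :
    (√m ^ m) ^ m * (2 ^ m) ^ k * ω ^ k ≤ 2 ^ m * (8 * ρ) ^ (k * m) := by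
  have hs := sqrt_pow_self_le k
  rw [← hm] at hs
  have hss : √(m : ℝ) ^ m * √(m : ℝ) ^ m = (m : ℝ) ^ m := by
    rw [← mul_pow, Real.mul_self_sqrt (by positivity)]
  set s := √(m : ℝ) ^ m with hsdef
  have hs0 : 0 ≤ s := by positivity
  have h1 : (2 * (m : ℝ) ^ m) ^ k ≤ (ρ ^ m) ^ k := by
    gcongr
    exact (two_mul_pow_self_le m (by omega)).trans (by gcongr)
  have h2 : ((m : ℝ) * (m + 1)) ^ k ≤ 2 ^ m * (2 ^ m) ^ k := by
    have : (m : ℝ) * (m + 1) ≤ 2 ^ (m + 1) := by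
      exact_mod_cast mul_succ_le_two_pow (by omega : 1 ≤ m)
    calc ((m : ℝ) * (m + 1)) ^ k ≤ (2 ^ (m + 1)) ^ k := by gcongr
      _ = 2 ^ k * (2 ^ m) ^ k := by rw [pow_succ, mul_pow]; ring
      _ ≤ _ := by
        gcongr
        · norm_num
        · omega
  have hpow : ∀ x : ℝ, x ^ m = x ^ k * x := fun x => by rw [hm, pow_succ]
  have e8 : (8 : ℝ) ^ (k * m) = (2 ^ m) ^ k * (2 ^ m) ^ k * (2 ^ m) ^ k := by
    rw [← mul_pow, ← mul_pow, ← mul_pow, ← mul_pow, ← pow_mul, mul_comm m k]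
    norm_num
  calc s ^ m * (2 ^ m) ^ k * ω ^ k
      ≤ s ^ m * (2 ^ m) ^ k * ((m + 1) * (2 * (s * 2 ^ m))) ^ k := by gcongr
    _ = s * (s * s) ^ k * ((2 ^ m) ^ k * (2 ^ m) ^ k) * 2 ^ k * ((m : ℝ) + 1) ^ k := by
        rw [hpow s]
        simp only [mul_pow]
        ring
    _ = s * (2 * (m : ℝ) ^ m) ^ k * ((2 ^ m) ^ k * (2 ^ m) ^ k) * ((m : ℝ) + 1) ^ k := by
        rw [hss, mul_pow 2]; ring
    _ ≤ (m : ℝ) ^ k * (ρ ^ m) ^ k * ((2 ^ m) ^ k * (2 ^ m) ^ k) * ((m : ℝ) + 1) ^ k := by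
        gcongr
    _ = (ρ ^ m) ^ k * ((2 ^ m) ^ k * (2 ^ m) ^ k) * ((m : ℝ) * (m + 1)) ^ k := by
        rw [mul_pow (m : ℝ)]; ring
    _ ≤ (ρ ^ m) ^ k * ((2 ^ m) ^ k * (2 ^ m) ^ k) * (2 ^ m * (2 ^ m) ^ k) := by
        have : 0 ≤ ρ := by linarith [(Nat.cast_nonneg m : (0 : ℝ) ≤ m)]
        gcongr
    _ = _ := by
        rw [mul_pow 8, e8, mul_comm k m, pow_mul]; ring

lemma sqrt_pow_mul_le_two_mul_pow {k m : ℕ} (hm : m = k + 1) {S a ω V : ℝ} (ha : 0 < a)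
    (hS : (m + 1) * a ≤ S) (hω : 0 ≤ ω) (hω' : ω ≤ (m + 1) * (2 * (√m ^ m * 2 ^ m)))
    (hVS : V ^ m ≤ (2 ^ m * S) ^ k)
    (hne : (8 * (S / a) * (S / ω) ^ (1 / (m : ℝ))) ^ k ≠ 0) :
    √m ^ m * V ≤ 2 * (8 * (S / a) * (S / ω) ^ (1 / (m : ℝ))) ^ k := by
  have hm0 : (m : ℝ) ≠ 0 := by rw [hm]; positivity
  have hS0 : 0 < S := lt_of_lt_of_le (by positivity) hS
  rcases hω.eq_or_lt with rfl | hω0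
  · rcases Nat.eq_zero_or_pos k with rfl | hk
    · subst hm
      simp at hVS ⊢
      linarith
    · rw [div_zero, Real.zero_rpow (by simpa using hm0), mul_zero, zero_pow hk.ne'] at hne
      exact absurd rfl hne
  have hρ : (m : ℝ) + 1 ≤ S / a := (le_div_iff₀ ha).2 hS
  have hkey := sqrt_pow_mul_two_pow_mul_pow_le hm hω hω' hρ
  refine le_of_pow_le_pow_left₀ (n := m) (by omega) (by positivity) ?_
  have e : ((S / ω) ^ (1 / (m : ℝ))) ^ m = S / ω := by
    rw [one_div, Real.rpow_inv_natCast_pow (by positivity) (by omega)]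
  calc (√m ^ m * V) ^ m = (√m ^ m) ^ m * V ^ m := mul_pow _ _ _
    _ ≤ (√m ^ m) ^ m * (2 ^ m * S) ^ k := by gcongr
    _ = (√m ^ m) ^ m * (2 ^ m) ^ k * ω ^ k * (S / ω) ^ k := by
        rw [mul_pow, div_pow]; field_simp
    _ ≤ 2 ^ m * (8 * (S / a)) ^ (k * m) * (S / ω) ^ k := by gcongr
    _ = _ := by
        conv_rhs => rw [mul_pow, ← pow_mul, mul_pow _ _ (k * m), mul_comm k m, pow_mul _ m k,
          pow_mul _ m k, e]
        rw [mul_comm k m, pow_mul]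
        ring

end Estimates

/-- STATEMENT 14: if `K` is a convex body with nonempty interior, centre of
mass at the origin, `λ` is the smallest eigenvalue of the coefficient matrix of
`Φ_{n-1}²(K)`, `S(K)` the surface area, and
`R = S(K)/(4πλ) · (S(K)/ω_n)^{1/(n-1)}` and
`r = 2πλ/((n+1)(4R)^{n-2})`, then `r Bⁿ ⊆ K`. -/
theorem stmt15 {n : ℕ} (hn : 2 ≤ n) (K : Set (En n))
    (hconv : Convex ℝ K) (hcomp : IsCompact K) (hint : (interior K).Nonempty)
    (hcent : (∫ x in K, x ∂(volume : Measure (En n))) = 0)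
    (μ : Measure (Sph n)) (hμ : IsSurfaceAreaMeasure K μ)
    (lam : ℝ) (hlampos : 0 < lam)
    (hlam : IsEigenvalue (rank2TensorMatrix μ) lam)
    (hlammin : ∀ l : ℝ, IsEigenvalue (rank2TensorMatrix μ) l → lam ≤ l)
    (R : ℝ)
    (hR : R = (μ Set.univ).toReal / (4 * π * lam)
        * (((μ Set.univ).toReal / omegaN n) ^ (1 / ((n : ℝ) - 1))))
    (r : ℝ) (hr : r = 2 * π * lam / (((n : ℝ) + 1) * (4 * R) ^ (n - 2))) :
    Metric.closedBall 0 r ⊆ K := by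
  obtain ⟨k, rfl⟩ := Nat.exists_eq_add_of_le' hn
  have hcast : ((k + 2 : ℕ) : ℝ) - 1 = ((k + 1 : ℕ) : ℝ) := by push_cast; ring
  have hμ' : ∀ ω, MeasurableSet ω → μ ω = μH[((k + 1 : ℕ) : ℝ)] (normalSet K ω) := by
    rcases hμ with ⟨-, h⟩ | ⟨h, -⟩
    · rw [hcast] at h
      exact h
    · exact absurd h hint.ne_empty
  have hfin := isFiniteMeasure_of_eq_normalSet hcomp hμ'
  obtain ⟨S, hS⟩ : ∃ S, S = (μ Set.univ).toReal := ⟨_, rfl⟩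
  obtain ⟨a, ha⟩ : ∃ a, a = 8 * π * lam := ⟨_, rfl⟩
  have hπ := Real.pi_pos
  have ha0 : 0 < a := by rw [ha]; positivity
  have hSa : (((k + 1 : ℕ) : ℝ) + 1) * a ≤ S := by
    have := mul_le_measure_univ hlammin
    rw [hS, ha]
    refine le_trans (le_of_eq ?_) this
    push_cast
    ring
  have hshadow : ∀ b : OrthonormalBasis (Fin (k + 2)) ℝ (En (k + 2)),
      volume (dropCoord b '' K) ≤ ENNReal.ofReal S := by
    intro b
    rw [hS, ENNReal.ofReal_toReal (measure_ne_top μ _), hμ' _ MeasurableSet.univ]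
    exact volume_image_dropCoord_le_normalSet hconv hcomp hint b
  have hR' : 4 * R = 8 * (S / a) * (S / omegaN (k + 2)) ^ (1 / ((k + 1 : ℕ) : ℝ)) := by
    rw [hR, hcast, ← hS, ha]
    field_simp
  have hKne : K.Nonempty := hint.mono interior_subset
  refine closedBall_subset_of_support hconv hcomp.isClosed hKne fun v hv => ?_
  obtain ⟨q, hq, hmax⟩ := hcomp.exists_isMaxOn hKne (f := fun x => ⟪v, x⟫_ℝ) (by fun_prop)
  obtain ⟨p, hp, hmin⟩ := hcomp.exists_isMinOn hKne (f := fun x => ⟪v, x⟫_ℝ) (by fun_prop)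
  have hcen := centroid_support_le hconv hcomp hint hcent hp fun x hx => isMaxOn_iff.1 hmax x hx
  obtain ⟨w, hw⟩ : ∃ w, w = ⟪v, q - p⟫_ℝ := ⟨_, rfl⟩
  have hwidth : ∀ x ∈ K, ∀ y ∈ K, ⟪v, x - y⟫_ℝ ≤ w := by
    intro x hx y hy
    rw [hw, inner_sub_right, inner_sub_right]
    linarith [isMaxOn_iff.1 hmax x hx, isMinOn_iff.1 hmin y hy]
  have hw0 : 0 ≤ w := by simpa using hwidth p hp p hp
  refine ⟨q, hq, ?_⟩
  rw [real_inner_comm]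
  rw [← hw] at hcen
  have hn1 : (0 : ℝ) < ((k + 2 : ℕ) : ℝ) + 1 := by positivity
  suffices h : 2 * π * lam / (4 * R) ^ k ≤ w by
    refine le_of_mul_le_mul_left (le_trans ?_ hcen) hn1
    rw [hr, Nat.add_sub_cancel]
    refine le_trans (le_of_eq ?_) h
    field_simp
  by_cases hne : (4 * R) ^ k = 0
  · rw [hne, div_zero]
    exact hw0
  obtain ⟨b, V, hV0, hbV, hVS⟩ := exists_volume_image_dropCoord_le_width_mul hconv hcomp hint
    (le_trans (by positivity) hSa) hshadow hv hwidth
  have hcauchy : a ≤ 2 * (√((k + 1 : ℕ) : ℝ) ^ (k + 1) * (w * V)) := by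
    have h1 := (ofReal_le_lintegral_abs_inner hlammin (b.norm_eq_one 0)).trans
      (lintegral_ofReal_abs_inner_le hcomp hμ' b)
    have h2 := h1.trans (mul_le_mul' le_rfl (mul_le_mul' le_rfl hbV))
    rw [← ENNReal.ofReal_mul hw0, ← ENNReal.ofReal_pow (by positivity),
      ← ENNReal.ofReal_mul (by positivity), ← ENNReal.ofReal_ofNat 2,
      ← ENNReal.ofReal_mul (by positivity), ← ha] at h2
    exact (ENNReal.ofReal_le_ofReal_iff (by positivity)).1 h2
  rw [hR'] at hne ⊢
  have hT := sqrt_pow_mul_le_two_mul_pow (ω := omegaN (k + 2)) rfl ha0 hSa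
    ENNReal.toReal_nonneg omegaN_le hVS hne
  have hRpos : 0 ≤ S / omegaN (k + 2) :=
    div_nonneg (le_trans (by positivity) hSa) ENNReal.toReal_nonneg
  have hS0 : 0 ≤ S := le_trans (by positivity) hSa
  have hTpos : 0 < (8 * (S / a) * (S / omegaN (k + 2)) ^ (1 / ((k + 1 : ℕ) : ℝ))) ^ k :=
    lt_of_le_of_ne (by positivity) (Ne.symm hne)
  rw [div_le_iff₀ hTpos]
  nlinarith [mul_le_mul_of_nonneg_left hT hw0]
end
end

section
/- Fix s_0 ≥ 2, a convex body K_0 ⊆ R^n with nonempty interior, and a vector y ∈ R^{m_{s_0}} (the noisy measurement ψ^{s_0}(K_0) + ε). Define D(μ) = ||y − ψ^{s_0}(μ)||^2 for finite Borel measures μ on S^{n-1} with vanishing first moments (the set M_0). Then: (a) the set H = {ψ^{s_0}(μ) : μ ∈ M_0} is a closed convex subset of R^{m_{s_0}}; (b) there exists a measure μ* ∈ M_0 supported on at most m_{s_0} points (an element of M_{m_{s_0}}) attaining inf_{μ ∈ M_0} D(μ); (c) any two minimizers of D over M_0 have identical moments up to order s_0. -/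
open MeasureTheory Metric Real Filter
open scoped InnerProductSpace ENNReal NNReal Topology

noncomputable section

/-- `f : S^{n-1} → ℝ` is a spherical harmonic of degree `k`. -/
def IsSphHarmonic {n : ℕ} (k : ℕ) (f : Sph n → ℝ) : Prop :=
  ∃ P : MvPolynomial (Fin n) ℝ, P.IsHomogeneous k ∧
    (∑ i, MvPolynomial.pderiv i (MvPolynomial.pderiv i P)) = 0 ∧
    ∀ u : Sph n, f u = MvPolynomial.eval (fun i => (u : En n) i) P

/-- `H k` is, for every degree `k`, an orthonormal basis of the space of
spherical harmonics of degree `k`. -/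
def IsHarmonicBasis {n : ℕ} (N : ℕ → ℕ) (H : (k : ℕ) → Fin (N k) → Sph n → ℝ) : Prop :=
  (∀ k j, IsSphHarmonic k (H k j)) ∧
  (∀ k, ∀ j j' : Fin (N k),
    ∫ u, H k j u * H k j' u ∂(sphLebesgue n) = if j = j' then 1 else 0) ∧
  (∀ k (f : Sph n → ℝ), IsSphHarmonic k f →
    ∃ c : Fin (N k) → ℝ, ∀ u, f u = ∑ j, c j * H k j u)

/-- The moment of a Borel measure on the sphere corresponding to the
multi-index `i : Fin n → ℕ`. -/
def sphMoment {n : ℕ} (μ : Measure (Sph n)) (i : Fin n → ℕ) : ℝ :=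
  ∫ u, ∏ j, ((u : En n) j) ^ (i j) ∂μ

/-- `μ ∈ M₀`: a finite Borel measure on the sphere with vanishing first order
moments. -/
def InM0 {n : ℕ} (μ : Measure (Sph n)) : Prop :=
  IsFiniteMeasure μ ∧ ∀ i : Fin n, ∫ u, (u : En n) i ∂μ = 0

namespace MvPolynomial
variable {n : ℕ}

/-- The Laplacian on real polynomials. -/
def laplacian : MvPolynomial (Fin n) ℝ →ₗ[ℝ] MvPolynomial (Fin n) ℝ :=
  ∑ i, (pderiv i).toLinearMap ∘ₗ (pderiv i).toLinearMap

lemma laplacian_apply (p : MvPolynomial (Fin n) ℝ) :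
    laplacian p = ∑ i, pderiv i (pderiv i p) := by
  simp [laplacian]

/-- The squared Euclidean norm as a polynomial. -/
def normSqPoly : MvPolynomial (Fin n) ℝ := ∑ i, X i ^ 2

lemma isHomogeneous_normSqPoly : (normSqPoly : MvPolynomial (Fin n) ℝ).IsHomogeneous 2 :=
  IsHomogeneous.sum _ _ _ fun i _ => isHomogeneous_X_pow i 2

lemma pderiv_normSqPoly (i : Fin n) :
    pderiv i (normSqPoly : MvPolynomial (Fin n) ℝ) = 2 * X i := by
  classical
  simp [normSqPoly, pderiv_X, Pi.single_apply, Derivation.leibniz_pow]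

lemma laplacian_normSqPoly_mul {p : MvPolynomial (Fin n) ℝ} {d : ℕ} (hp : p.IsHomogeneous d) :
    laplacian (normSqPoly * p) =
      ((2 * n + 4 * d : ℕ) : ℝ) • p + normSqPoly * laplacian p := by
  have key : ∀ i, pderiv i (pderiv i (normSqPoly * p)) =
      2 * p + 4 * (X i * pderiv i p) + normSqPoly * pderiv i (pderiv i p) := by
    intro i
    have h2 : pderiv i (2 : MvPolynomial (Fin n) ℝ) = 0 := by
      exact_mod_cast (pderiv i).map_natCast 2
    simp only [Derivation.leibniz, pderiv_normSqPoly, map_add, pderiv_X_self, smul_eq_mul, h2]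
    ring
  rw [laplacian_apply, laplacian_apply, Finset.sum_congr rfl fun i _ => key i,
    Finset.sum_add_distrib, Finset.sum_add_distrib, ← Finset.mul_sum, ← Finset.mul_sum,
    ← Finset.mul_sum, hp.sum_X_mul_pderiv]
  simp only [smul_eq_C_mul, Finset.sum_const, Finset.card_univ, Fintype.card_fin, nsmul_eq_mul,
    map_natCast]
  push_cast
  ring

lemma laplacian_normSqPoly_pow_mul (hn : 0 < n) {h : MvPolynomial (Fin n) ℝ} {d : ℕ}
    (hd : h.IsHomogeneous d) (hh : laplacian h = 0) (j : ℕ) :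
    ∃ c : ℝ, 0 < c ∧
      laplacian (normSqPoly ^ (j + 1) * h) = c • (normSqPoly ^ j * h) := by
  induction j with
  | zero =>
    refine ⟨((2 * n + 4 * d : ℕ) : ℝ), by positivity, ?_⟩
    simp [laplacian_normSqPoly_mul hd, hh]
  | succ j ih =>
    obtain ⟨c, hc, e⟩ := ih
    refine ⟨((2 * n + 4 * (2 * (j + 1) + d) : ℕ) : ℝ) + c, by positivity, ?_⟩
    have hom : (normSqPoly ^ (j + 1) * h).IsHomogeneous (2 * (j + 1) + d) :=
      (isHomogeneous_normSqPoly.pow _).mul hd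
    rw [pow_succ', mul_assoc, laplacian_normSqPoly_mul hom, e, add_smul, mul_smul_comm,
      pow_succ' _ j, mul_assoc]

lemma iterate_laplacian_normSqPoly_pow_mul (hn : 0 < n) {h : MvPolynomial (Fin n) ℝ} {d : ℕ}
    (hd : h.IsHomogeneous d) (hh : laplacian h = 0) (j : ℕ) :
    ∃ c : ℝ, 0 < c ∧ (laplacian ^ j) (normSqPoly ^ j * h) = c • h := by
  induction j with
  | zero => exact ⟨1, one_pos, by simp⟩
  | succ j ih =>
    obtain ⟨c, hc, e⟩ := ih
    obtain ⟨c', hc', e'⟩ := laplacian_normSqPoly_pow_mul hn hd hh j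
    refine ⟨c' * c, by positivity, ?_⟩
    rw [pow_succ, Module.End.mul_apply, e', map_smul, e, smul_smul]

lemma IsHomogeneous.laplacian {p : MvPolynomial (Fin n) ℝ} {d : ℕ} (hp : p.IsHomogeneous d) :
    (laplacian p).IsHomogeneous (d - 2) := by
  rw [laplacian_apply]
  exact IsHomogeneous.sum _ _ _ fun i _ => hp.pderiv.pderiv

lemma IsHomogeneous.iterate_laplacian {p : MvPolynomial (Fin n) ℝ} {d : ℕ}
    (hp : p.IsHomogeneous d) (j : ℕ) :
    ((MvPolynomial.laplacian ^ j) p).IsHomogeneous (d - 2 * j) := by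
  induction j with
  | zero => simpa
  | succ j ih =>
    rw [pow_succ', Module.End.mul_apply, show d - 2 * (j + 1) = d - 2 * j - 2 by omega]
    exact ih.laplacian

lemma IsHomogeneous.laplacian_eq_zero {p : MvPolynomial (Fin n) ℝ} {d : ℕ}
    (hp : p.IsHomogeneous d) (hd : d ≤ 1) : MvPolynomial.laplacian p = 0 := by
  rw [laplacian_apply]
  refine Finset.sum_eq_zero fun i _ => ?_
  have h : (pderiv i p).IsHomogeneous 0 := by
    simpa [Nat.sub_eq_zero_of_le hd] using hp.pderiv (i := i)
  rw [← totalDegree_zero_iff_isHomogeneous, totalDegree_eq_zero_iff_eq_C] at h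
  rw [h, pderiv_C]

/-- If membership in a subspace of polynomials is unaffected by factors `normSqPoly`, and the
subspace contains all harmonic homogeneous polynomials of degree at most `s`, then it contains all
homogeneous polynomials of degree at most `s`. -/
lemma IsHomogeneous.mem_of_harmonic_mem (hn : 0 < n) {s : ℕ}
    (V : Submodule ℝ (MvPolynomial (Fin n) ℝ))
    (hV : ∀ p q, normSqPoly ^ q * p ∈ V ↔ p ∈ V)
    (hharm : ∀ d ≤ s, ∀ p : MvPolynomial (Fin n) ℝ, p.IsHomogeneous d →
      MvPolynomial.laplacian p = 0 → p ∈ V)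
    {p : MvPolynomial (Fin n) ℝ} {d : ℕ} (hp : p.IsHomogeneous d) (hd : d ≤ s) : p ∈ V := by
  have key : ∀ k, 2 * k ≤ d → ∀ p : MvPolynomial (Fin n) ℝ, p.IsHomogeneous d →
      (MvPolynomial.laplacian ^ (k + 1)) p = 0 → p ∈ V := by
    intro k
    induction k with
    | zero =>
      intro _ p hp h
      exact hharm d hd p hp (by simpa using h)
    | succ k ih =>
      intro hk p hp h0
      set h := (MvPolynomial.laplacian ^ (k + 1)) p with hh
      have hhom : h.IsHomogeneous (d - 2 * (k + 1)) := hp.iterate_laplacian _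
      have hlap : MvPolynomial.laplacian h = 0 := by
        rwa [pow_succ', Module.End.mul_apply] at h0
      obtain ⟨c, hc, e⟩ := iterate_laplacian_normSqPoly_pow_mul hn hhom hlap (k + 1)
      have hV' : c⁻¹ • (normSqPoly ^ (k + 1) * h) ∈ V :=
        V.smul_mem _ ((hV _ _).2 (hharm _ (by omega) _ hhom hlap))
      have hr : (normSqPoly ^ (k + 1) * h).IsHomogeneous d := by
        have := (isHomogeneous_normSqPoly.pow (k + 1)).mul hhom
        rwa [show 2 * (k + 1) + (d - 2 * (k + 1)) = d by omega] at this
      have hsub : p - c⁻¹ • (normSqPoly ^ (k + 1) * h) ∈ V := by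
        refine ih (by omega) _ (hp.sub ?_) ?_
        · rw [smul_eq_C_mul]; exact hr.C_mul _
        · rw [map_sub, map_smul, e, smul_smul, inv_mul_cancel₀ hc.ne', one_smul, ← hh, sub_self]
      simpa using V.add_mem hsub hV'
  refine key (d / 2) (by omega) p hp ?_
  rw [pow_succ', Module.End.mul_apply]
  exact (hp.iterate_laplacian _).laplacian_eq_zero (by omega)

end MvPolynomial

section ConicHull

variable {X I : Type*} [Fintype I] {Φ : X → I → ℝ} {c : I → ℝ}

/-- Carathéodory's theorem for a family inside an affine hyperplane that avoids the origin. -/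
lemma exists_sum_smul_eq_of_mem_convexHull [Nonempty X] (hc : ∀ u, ∑ i, c i * Φ u i = 1)
    {z : I → ℝ} (hz : z ∈ convexHull ℝ (Set.range Φ)) :
    ∃ (α : Fin (Fintype.card I) → ℝ) (w : Fin (Fintype.card I) → X),
      (∀ j, 0 ≤ α j) ∧ ∑ j, α j = 1 ∧ ∑ j, α j • Φ (w j) = z := by
  obtain ⟨ι, _, v, a, hv, hind, ha, ha1, hsum⟩ := eq_pos_convex_span_of_mem_convexHull hz
  choose x hx using fun i => hv ⟨i, rfl⟩
  have hlin : LinearIndependent ℝ v := by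
    rw [Fintype.linearIndependent_iff]
    intro g hg
    rw [affineIndependent_iff] at hind
    have hg0 : ∑ i, g i = 0 := by
      calc ∑ i, g i = ∑ i, g i * ∑ k, c k * v i k := by
            simp_rw [← hx, hc, mul_one]
        _ = ∑ k, c k * (∑ i, g i • v i) k := by
            simp_rw [Finset.sum_apply, Finset.mul_sum, Pi.smul_apply, smul_eq_mul]
            rw [Finset.sum_comm]
            exact Finset.sum_congr rfl fun _ _ => Finset.sum_congr rfl fun _ _ => by ring
        _ = 0 := by rw [hg]; simp
    exact fun i => hind Finset.univ g hg0 hg i (Finset.mem_univ i)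
  have hcard : Fintype.card ι ≤ Fintype.card (Fin (Fintype.card I)) := by
    simpa using hlin.fintype_card_le_finrank
  obtain ⟨e⟩ := Function.Embedding.nonempty_of_card_le hcard
  have h0 : ∀ j ∉ Set.range e, Function.extend e a 0 j = 0 := fun j hj => by
    rw [Function.extend_apply' _ _ _ (by simpa using hj)]; rfl
  refine ⟨Function.extend e a 0, Function.extend e x fun _ => Classical.arbitrary X, ?_, ?_, ?_⟩
  · intro j
    by_cases hj : j ∈ Set.range e
    · obtain ⟨i, rfl⟩ := hj
      rw [e.injective.extend_apply]
      exact (ha i).le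
    · exact (h0 j hj).ge
  · rw [← ha1]
    exact (Fintype.sum_of_injective e e.injective _ _ h0
      fun i => (e.injective.extend_apply _ _ _).symm).symm
  · rw [← hsum]
    refine (Fintype.sum_of_injective e e.injective _ _ (fun j hj => by rw [h0 j hj, zero_smul])
      fun i => ?_).symm
    rw [e.injective.extend_apply, e.injective.extend_apply, hx]

lemma isCompact_convexHull_range [Nonempty X] [TopologicalSpace X] [CompactSpace X]
    (hΦ : Continuous Φ) (hc : ∀ u, ∑ i, c i * Φ u i = 1) :
    IsCompact (convexHull ℝ (Set.range Φ)) := by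
  have himg : convexHull ℝ (Set.range Φ) =
      (fun p : (Fin (Fintype.card I) → ℝ) × (Fin (Fintype.card I) → X) =>
        ∑ j, p.1 j • Φ (p.2 j)) '' (stdSimplex ℝ (Fin (Fintype.card I)) ×ˢ Set.univ) := by
    ext z
    constructor
    · intro hz
      obtain ⟨α, w, h0, h1, hs⟩ := exists_sum_smul_eq_of_mem_convexHull hc hz
      exact ⟨(α, w), ⟨⟨h0, h1⟩, trivial⟩, hs⟩
    · rintro ⟨⟨α, w⟩, ⟨⟨h0, h1⟩, -⟩, rfl⟩
      exact (convex_convexHull ℝ _).sum_mem (fun j _ => h0 j) h1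
        fun j _ => subset_convexHull ℝ _ ⟨w j, rfl⟩
  rw [himg]
  exact ((isCompact_stdSimplex ℝ _).prod isCompact_univ).image (by fun_prop)

lemma isClosed_setOf_mem_smul {K : Set (I → ℝ)} (hK : IsCompact K) :
    IsClosed {x : I → ℝ | 0 ≤ ∑ i, c i * x i ∧ ∃ z ∈ K, (∑ i, c i * x i) • z = x} := by
  have : CompactSpace K := isCompact_iff_compactSpace.1 hK
  have hcl : IsClosed {p : (I → ℝ) × K |
      0 ≤ ∑ i, c i * p.1 i ∧ (∑ i, c i * p.1 i) • (p.2 : I → ℝ) = p.1} :=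
    (isClosed_le (f := fun _ : (I → ℝ) × K => (0 : ℝ)) (g := fun p => ∑ i, c i * p.1 i)
      (by fun_prop) (by fun_prop)).inter
    (isClosed_eq (f := fun p : (I → ℝ) × K => (∑ i, c i * p.1 i) • (p.2 : I → ℝ))
      (g := fun p => p.1) (by fun_prop) (by fun_prop))
  convert isClosedMap_fst_of_compactSpace _ hcl using 1
  ext x
  simp

variable [TopologicalSpace X] [CompactSpace X] [MeasurableSpace X] [BorelSpace X]

lemma Continuous.integrable_of_compactSpace {f : X → ℝ} (hf : Continuous f) (μ : Measure X)
    [IsFiniteMeasure μ] : Integrable f μ := by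
  refine hf.integrable_of_hasCompactSupport ?_
  exact HasCompactSupport.of_compactSpace f

lemma exists_mem_convexHull_integral_eq_smul [Nonempty X]
    (hΦ : Continuous Φ) (hc : ∀ u, ∑ i, c i * Φ u i = 1) (μ : Measure X) [IsFiniteMeasure μ] :
    ∃ z ∈ convexHull ℝ (Set.range Φ), μ.real Set.univ • z = fun i => ∫ u, Φ u i ∂μ := by
  have hi : ∀ i, Integrable (fun u => Φ u i) μ := fun i =>
    (show Continuous fun u => Φ u i by fun_prop).integrable_of_compactSpace μ
  rcases eq_zero_or_neZero μ with rfl | hμ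
  · exact ⟨_, subset_convexHull ℝ _ ⟨Classical.arbitrary X, rfl⟩, by ext; simp⟩
  · refine ⟨⨍ u, Φ u ∂μ, ?_, ?_⟩
    · exact (convex_convexHull ℝ _).average_mem (isCompact_convexHull_range hΦ hc).isClosed
        (.of_forall fun u => subset_convexHull ℝ _ ⟨u, rfl⟩) (.of_eval hi)
    · rw [measure_smul_average]
      ext i
      exact eval_integral hi i

lemma sum_mul_integral_eq_measureReal (hΦ : Continuous Φ) (hc : ∀ u, ∑ i, c i * Φ u i = 1)
    (μ : Measure X) [IsFiniteMeasure μ] :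
    ∑ i, c i * ∫ u, Φ u i ∂μ = μ.real Set.univ := by
  have hi : ∀ i, Integrable (fun u => Φ u i) μ := fun i =>
    (show Continuous fun u => Φ u i by fun_prop).integrable_of_compactSpace μ
  simp_rw [← integral_const_mul]
  rw [← integral_finsetSum _ fun i _ => (hi i).const_mul _]
  simp [hc]

lemma integral_sum_smul_dirac [MeasurableSingletonClass X] {m : ℕ} {α : Fin m → ℝ}
    (hα : ∀ j, 0 ≤ α j) (w : Fin m → X) {f : X → ℝ} (hf : Continuous f) :
    ∫ u, f u ∂(∑ j, ENNReal.ofReal (α j) • Measure.dirac (w j)) = ∑ j, α j * f (w j) := by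
  rw [integral_finsetSum_measure fun j _ =>
    (hf.integrable_of_compactSpace _).smul_measure ENNReal.ofReal_ne_top]
  refine Finset.sum_congr rfl fun j _ => ?_
  rw [integral_smul_measure, integral_dirac, ENNReal.toReal_ofReal (hα j), smul_eq_mul]

/-- Every point of the cone over the convex hull of `Φ` is the moment vector of a discrete measure
with at most as many atoms as there are moments. -/
lemma exists_discrete_integral_eq [MeasurableSingletonClass X] [Nonempty X]
    (hΦ : Continuous Φ) (hc : ∀ u, ∑ i, c i * Φ u i = 1) {t : ℝ} (ht : 0 ≤ t) {z : I → ℝ}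
    (hz : z ∈ convexHull ℝ (Set.range Φ)) {m : ℕ} (hm : Fintype.card I = m) :
    ∃ (α : Fin m → ℝ) (w : Fin m → X), (∀ j, 0 ≤ α j) ∧
      ∀ i, ∫ u, Φ u i ∂(∑ j, ENNReal.ofReal (α j) • Measure.dirac (w j)) = t * z i := by
  subst hm
  obtain ⟨α, w, h0, -, hs⟩ := exists_sum_smul_eq_of_mem_convexHull hc hz
  have h0' : ∀ j, 0 ≤ t * α j := fun j => mul_nonneg ht (h0 j)
  refine ⟨fun j => t * α j, w, h0', fun i => ?_⟩
  rw [integral_sum_smul_dirac h0' w (f := fun u => Φ u i) (by fun_prop), ← hs]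
  simp [Finset.mul_sum, mul_assoc]

end ConicHull

section SphericalHarmonics

variable {n : ℕ}

lemma continuous_eval_sphere (p : MvPolynomial (Fin n) ℝ) :
    Continuous fun u : Sph n => MvPolynomial.eval (fun i => (u : En n) i) p :=
  (MvPolynomial.continuous_eval p).comp (by fun_prop)

lemma IsSphHarmonic.continuous {k : ℕ} {f : Sph n → ℝ} (hf : IsSphHarmonic k f) :
    Continuous f := by
  obtain ⟨P, -, -, hP⟩ := hf
  simpa only [funext hP] using continuous_eval_sphere P

lemma eval_normSqPoly_sphere (u : Sph n) :
    MvPolynomial.eval (fun i => (u : En n) i) MvPolynomial.normSqPoly = 1 := by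
  have h : ‖(u : En n)‖ = 1 := by simp
  have h2 := EuclideanSpace.real_norm_sq_eq (u : En n)
  rw [h] at h2
  simp [MvPolynomial.normSqPoly, ← h2]

/-- The polynomials whose restriction to the sphere lies in the span of the family `Φ`. -/
def sphereSpan {I : Type*} [Fintype I] (Φ : Sph n → I → ℝ) :
    Submodule ℝ (MvPolynomial (Fin n) ℝ) where
  carrier := {p | ∃ c : I → ℝ, ∀ u : Sph n,
    MvPolynomial.eval (fun i => (u : En n) i) p = ∑ i, c i * Φ u i}
  zero_mem' := ⟨0, by simp⟩
  add_mem' := by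
    rintro p q ⟨c, hc⟩ ⟨d, hd⟩
    exact ⟨c + d, fun u => by simp [hc, hd, add_mul, Finset.sum_add_distrib]⟩
  smul_mem' := by
    rintro a p ⟨c, hc⟩
    exact ⟨a • c, fun u => by simp [hc, MvPolynomial.smul_eval, Finset.mul_sum, mul_assoc]⟩

/-- On the sphere, every homogeneous polynomial of degree at most `s` is a linear combination of
the basis spherical harmonics of degrees at most `s`. -/
lemma IsHarmonicBasis.exists_eval_eq_sum (hn : 0 < n) {N : ℕ → ℕ}
    {H : (k : ℕ) → Fin (N k) → Sph n → ℝ} (hH : IsHarmonicBasis N H) {s d : ℕ} (hd : d ≤ s)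
    {p : MvPolynomial (Fin n) ℝ} (hp : p.IsHomogeneous d) :
    ∃ c : (Σ k : Fin (s + 1), Fin (N k)) → ℝ, ∀ u : Sph n,
      MvPolynomial.eval (fun i => (u : En n) i) p = ∑ i, c i * H i.1 i.2 u := by
  refine hp.mem_of_harmonic_mem hn (s := s)
    (sphereSpan fun u (i : Σ k : Fin (s + 1), Fin (N k)) => H i.1 i.2 u) ?_ ?_ hd
  · intro p q
    refine exists_congr fun c => forall_congr' fun u => ?_
    rw [map_mul, map_pow, eval_normSqPoly_sphere, one_pow, one_mul]
  · intro d hd p hp hlap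
    obtain ⟨c, hc⟩ := hH.2.2 d (fun u => MvPolynomial.eval (fun i => (u : En n) i) p)
      ⟨p, hp, by rwa [← MvPolynomial.laplacian_apply], fun _ => rfl⟩
    have hd' : d < s + 1 := Nat.lt_succ_of_le hd
    refine ⟨fun i => if h : (i.1 : ℕ) = d then c (Fin.cast (congrArg N h) i.2) else 0,
      fun u => ?_⟩
    rw [hc u, Fintype.sum_sigma, Finset.sum_eq_single (⟨d, hd'⟩ : Fin (s + 1))]
    · simp
    · intro k _ hk
      have : (k : ℕ) ≠ d := fun h => hk (Fin.ext h)
      simp [this]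
    · simp

end SphericalHarmonics

lemma exists_isMinOn_sum_sub_sq {I : Type*} [Fintype I] {S : Set (I → ℝ)} (hS : IsClosed S)
    (hne : S.Nonempty) (y : I → ℝ) :
    ∃ x ∈ S, ∀ x' ∈ S, ∑ i, (y i - x i) ^ 2 ≤ ∑ i, (y i - x' i) ^ 2 := by
  have hcl : IsClosed {x : EuclideanSpace ℝ I | x.ofLp ∈ S} :=
    hS.preimage (PiLp.continuous_ofLp 2 _)
  obtain ⟨x₀, hx₀⟩ := hne
  obtain ⟨x, hx, hd⟩ := hcl.exists_infDist_eq_dist ⟨WithLp.toLp 2 x₀, hx₀⟩ (WithLp.toLp 2 y)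
  refine ⟨x.ofLp, hx, fun x' hx' => ?_⟩
  have hle : dist (WithLp.toLp 2 y) x ≤ dist (WithLp.toLp 2 y) (WithLp.toLp 2 x') := by
    rw [← hd]
    exact infDist_le_dist_of_mem hx'
  simpa [EuclideanSpace.dist_eq, Real.dist_eq, sq_abs,
    Real.sqrt_le_sqrt_iff (Finset.sum_nonneg fun i _ => sq_nonneg _)] using hle

/-- Uniqueness of the metric projection onto a convex set. -/
lemma eq_of_isMinOn_sum_sub_sq {I : Type*} [Fintype I] {S : Set (I → ℝ)} (hS : Convex ℝ S)
    {y a b : I → ℝ} (ha : a ∈ S) (hb : b ∈ S)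
    (hma : ∀ x ∈ S, ∑ i, (y i - a i) ^ 2 ≤ ∑ i, (y i - x i) ^ 2)
    (hmb : ∀ x ∈ S, ∑ i, (y i - b i) ^ 2 ≤ ∑ i, (y i - x i) ^ 2) : a = b := by
  have hmid := hS ha hb (by norm_num : (0 : ℝ) ≤ 1 / 2) (by norm_num : (0 : ℝ) ≤ 1 / 2)
    (by norm_num)
  have h1 := hma _ hmid
  have h2 := hmb _ hmid
  have hpar : 2 * ∑ i, (y i - ((1 / 2 : ℝ) • a + (1 / 2 : ℝ) • b) i) ^ 2 +
      1 / 2 * ∑ i, (a i - b i) ^ 2 = ∑ i, (y i - a i) ^ 2 + ∑ i, (y i - b i) ^ 2 := by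
    simp only [Finset.mul_sum, ← Finset.sum_add_distrib, Pi.add_apply, Pi.smul_apply, smul_eq_mul]
    exact Finset.sum_congr rfl fun i _ => by ring
  have h0 : ∑ i, (a i - b i) ^ 2 = 0 :=
    le_antisymm (by linarith) (Finset.sum_nonneg fun i _ => sq_nonneg _)
  rw [Finset.sum_eq_zero_iff_of_nonneg fun i _ => sq_nonneg _] at h0
  ext i
  exact sub_eq_zero.1 (pow_eq_zero_iff two_ne_zero |>.1 (h0 i (Finset.mem_univ i)))

/-- fix `s₀ ≥ 2` and a noisy measurement vector
`y ∈ ℝ^{m_{s₀}}` (indexed by pairs `(k, j)` with `k ≤ s₀`, `j < N k`), and let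
`D(μ) = ‖y - ψ^{s₀}(μ)‖²` on `M₀`. Then (a) the set
`H = {ψ^{s₀}(μ) : μ ∈ M₀}` is closed and convex; (b) some measure in `M₀`
supported on at most `m_{s₀} = ∑_{k ≤ s₀} N k` points minimizes `D`; and (c)
any two minimizers of `D` over `M₀` have identical moments up to order `s₀`. -/
theorem stmt17 {n : ℕ} (hn : 2 ≤ n) (s₀ : ℕ) (hs₀ : 2 ≤ s₀)
    (N : ℕ → ℕ) (H : (k : ℕ) → Fin (N k) → Sph n → ℝ) (hH : IsHarmonicBasis N H)
    (y : (Σ k : Fin (s₀ + 1), Fin (N k)) → ℝ)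
    (ψ : Measure (Sph n) → (Σ k : Fin (s₀ + 1), Fin (N k)) → ℝ)
    (hψ : ∀ μ i, ψ μ i = ∫ u, H i.1 i.2 u ∂μ)
    (D : Measure (Sph n) → ℝ)
    (hD : ∀ μ, D μ = ∑ i, (y i - ψ μ i) ^ 2) :
    (IsClosed {x : (Σ k : Fin (s₀ + 1), Fin (N k)) → ℝ | ∃ μ, InM0 μ ∧ ψ μ = x} ∧
      Convex ℝ {x : (Σ k : Fin (s₀ + 1), Fin (N k)) → ℝ | ∃ μ, InM0 μ ∧ ψ μ = x}) ∧
    (∃ (α : Fin (∑ k ∈ Finset.range (s₀ + 1), N k) → ℝ)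
       (w : Fin (∑ k ∈ Finset.range (s₀ + 1), N k) → Sph n),
      (∀ j, 0 ≤ α j) ∧
      InM0 (∑ j, ENNReal.ofReal (α j) • Measure.dirac (w j)) ∧
      ∀ μ, InM0 μ → D (∑ j, ENNReal.ofReal (α j) • Measure.dirac (w j)) ≤ D μ) ∧
    (∀ μ₁ μ₂, InM0 μ₁ → InM0 μ₂ →
      (∀ μ, InM0 μ → D μ₁ ≤ D μ) → (∀ μ, InM0 μ → D μ₂ ≤ D μ) →
      ∀ i : Fin n → ℕ, (∑ j, i j) ≤ s₀ → sphMoment μ₁ i = sphMoment μ₂ i) := by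
  have hn0 : 0 < n := by omega
  have : Nonempty (Sph n) := ⟨⟨EuclideanSpace.single ⟨0, hn0⟩ 1, by simp⟩⟩
  set Φ : Sph n → (Σ k : Fin (s₀ + 1), Fin (N k)) → ℝ := fun u i => H i.1 i.2 u
  have hΦ : Continuous Φ := continuous_pi fun i => (hH.1 i.1 i.2).continuous
  have hψ' : ∀ μ, ψ μ = fun i => ∫ u, Φ u i ∂μ := fun μ => funext (hψ μ)
  have hcard : Fintype.card (Σ k : Fin (s₀ + 1), Fin (N k)) =
      ∑ k ∈ Finset.range (s₀ + 1), N k := by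
    simp [Fintype.card_sigma, Fin.sum_univ_eq_sum_range]
  have hint : ∀ (μ : Measure (Sph n)) [IsFiniteMeasure μ] {p : MvPolynomial (Fin n) ℝ}
      {c : (Σ k : Fin (s₀ + 1), Fin (N k)) → ℝ},
      (∀ u : Sph n, MvPolynomial.eval (fun i => (u : En n) i) p = ∑ i, c i * Φ u i) →
      ∫ u : Sph n, MvPolynomial.eval (fun i => (u : En n) i) p ∂μ = ∑ i, c i * ψ μ i := by
    intro μ _ p c hc
    simp_rw [hc, hψ', ← integral_const_mul]
    exact integral_finsetSum _ fun i _ =>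
      ((hH.1 i.1 i.2).continuous.integrable_of_compactSpace μ).const_mul _
  obtain ⟨c, hc⟩ := hH.exists_eval_eq_sum hn0 (Nat.zero_le s₀) (MvPolynomial.isHomogeneous_one _ ℝ)
  replace hc : ∀ u, ∑ i, c i * Φ u i = 1 := fun u => by simpa using (hc u).symm
  choose l hl using fun i : Fin n =>
    hH.exists_eval_eq_sum hn0 (by omega : 1 ≤ s₀) (MvPolynomial.isHomogeneous_X ℝ i)
  have hM0 : ∀ (μ : Measure (Sph n)) [IsFiniteMeasure μ],
      InM0 μ ↔ ∀ i, ∑ j, l i j * ψ μ j = 0 := by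
    intro μ hμ
    simp only [InM0, hμ, true_and]
    refine forall_congr' fun i => ?_
    rw [← hint μ (hl i)]
    simp
  set S := {x : (Σ k : Fin (s₀ + 1), Fin (N k)) → ℝ | ∃ μ, InM0 μ ∧ ψ μ = x}
  set T : Set ((Σ k : Fin (s₀ + 1), Fin (N k)) → ℝ) :=
    {x | 0 ≤ ∑ i, c i * x i ∧ ∃ z ∈ convexHull ℝ (Set.range Φ), (∑ i, c i * x i) • z = x} ∩
      {x | ∀ i, ∑ j, l i j * x j = 0}
  have hST : ∀ μ, InM0 μ → ψ μ ∈ T := by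
    intro μ hμ
    have := hμ.1
    have hmass : ∑ i, c i * ψ μ i = μ.real Set.univ := by
      simpa only [hψ'] using sum_mul_integral_eq_measureReal hΦ hc μ
    refine ⟨⟨hmass ▸ measureReal_nonneg, ?_⟩, (hM0 μ).1 hμ⟩
    rw [hmass, hψ']
    exact exists_mem_convexHull_integral_eq_smul hΦ hc μ
  have hTS : ∀ x ∈ T, ∃ (α : Fin (∑ k ∈ Finset.range (s₀ + 1), N k) → ℝ)
      (w : Fin (∑ k ∈ Finset.range (s₀ + 1), N k) → Sph n), (∀ j, 0 ≤ α j) ∧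
        InM0 (∑ j, ENNReal.ofReal (α j) • Measure.dirac (w j)) ∧
        ψ (∑ j, ENNReal.ofReal (α j) • Measure.dirac (w j)) = x := by
    rintro x ⟨⟨h0, z, hz, hx⟩, hlx⟩
    obtain ⟨α, w, hα, hαw⟩ := exists_discrete_integral_eq hΦ hc h0 hz hcard
    have hψx : ψ (∑ j, ENNReal.ofReal (α j) • Measure.dirac (w j)) = x := by
      rw [hψ', funext hαw]
      exact hx
    have hfin : ∀ j, IsFiniteMeasure (ENNReal.ofReal (α j) • Measure.dirac (w j)) := fun j =>
      Measure.smul_finite _ ENNReal.ofReal_ne_top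
    exact ⟨α, w, hα, (hM0 _).2 (by rwa [hψx]), hψx⟩
  have hSeq : S = T := by
    ext x
    constructor
    · rintro ⟨μ, hμ, rfl⟩
      exact hST μ hμ
    · intro hx
      obtain ⟨α, w, -, hw, hwx⟩ := hTS x hx
      exact ⟨_, hw, hwx⟩
  have hclosed : IsClosed S := by
    rw [hSeq]
    refine (isClosed_setOf_mem_smul (isCompact_convexHull_range hΦ hc)).inter ?_
    simp only [Set.ofPred_forall]
    exact isClosed_iInter fun i => isClosed_eq (by fun_prop) continuous_const
  have hconvex : Convex ℝ S := by
    rintro _ ⟨μ, hμ, rfl⟩ _ ⟨ν, hν, rfl⟩ a b ha hb -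
    have := hμ.1
    have := hν.1
    have := Measure.smul_finite μ (ENNReal.ofReal_ne_top (r := a))
    have := Measure.smul_finite ν (ENNReal.ofReal_ne_top (r := b))
    have hcomb : ψ (ENNReal.ofReal a • μ + ENNReal.ofReal b • ν) = a • ψ μ + b • ψ ν := by
      ext i
      have hi : Continuous (H i.1 i.2) := (hH.1 i.1 i.2).continuous
      rw [hψ, integral_add_measure (hi.integrable_of_compactSpace _)
        (hi.integrable_of_compactSpace _), integral_smul_measure, integral_smul_measure,
        ENNReal.toReal_ofReal ha, ENNReal.toReal_ofReal hb, ← hψ, ← hψ]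
      rfl
    refine ⟨_, (hM0 _).2 fun i => ?_, hcomb⟩
    have h1 := (hM0 μ).1 hμ i
    have h2 := (hM0 ν).1 hν i
    calc ∑ j, l i j * ψ (ENNReal.ofReal a • μ + ENNReal.ofReal b • ν) j
        = a * ∑ j, l i j * ψ μ j + b * ∑ j, l i j * ψ ν j := by
          rw [hcomb, Finset.mul_sum, Finset.mul_sum, ← Finset.sum_add_distrib]
          exact Finset.sum_congr rfl fun j _ => by
            simp only [Pi.add_apply, Pi.smul_apply, smul_eq_mul]; ring
      _ = 0 := by rw [h1, h2]; ring
  have hmem : ∀ μ, InM0 μ → ψ μ ∈ S := fun μ hμ => ⟨μ, hμ, rfl⟩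
  refine ⟨⟨hclosed, hconvex⟩, ?_, ?_⟩
  · have hne : S.Nonempty := ⟨_, hmem 0 ⟨inferInstance, by simp⟩⟩
    obtain ⟨x, hx, hmin⟩ := exists_isMinOn_sum_sub_sq hclosed hne y
    obtain ⟨α, w, hα, hw, hwx⟩ := hTS x (hSeq ▸ hx)
    refine ⟨α, w, hα, hw, fun μ hμ => ?_⟩
    rw [hD, hD, hwx]
    exact hmin _ (hmem μ hμ)
  · intro μ₁ μ₂ h₁ h₂ hmin₁ hmin₂ i hi
    have hmin : ∀ μ, (∀ ν, InM0 ν → D μ ≤ D ν) →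
        ∀ x ∈ S, ∑ j, (y j - ψ μ j) ^ 2 ≤ ∑ j, (y j - x j) ^ 2 := by
      rintro μ hμ _ ⟨ν, hν, rfl⟩
      simpa only [hD] using hμ ν hν
    have heq : ψ μ₁ = ψ μ₂ := eq_of_isMinOn_sum_sub_sq hconvex (hmem _ h₁) (hmem _ h₂)
      (hmin _ hmin₁) (hmin _ hmin₂)
    have := h₁.1
    have := h₂.1
    have hhom : (∏ j, MvPolynomial.X j ^ i j : MvPolynomial (Fin n) ℝ).IsHomogeneous (∑ j, i j) :=
      MvPolynomial.IsHomogeneous.prod _ _ _ fun j _ => MvPolynomial.isHomogeneous_X_pow j _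
    obtain ⟨e, he⟩ := hH.exists_eval_eq_sum hn0 hi hhom
    have hmom : ∀ (μ : Measure (Sph n)) [IsFiniteMeasure μ],
        sphMoment μ i = ∑ j, e j * ψ μ j := by
      intro μ _
      rw [← hint μ he]
      simp [sphMoment]
    rw [hmom, hmom, heq]
end
end
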